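/- arXiv:1409.6090 — 2 statements merged into one kernel-verified Lean document; each statement's English description precedes it below -/
import Mathlib

section
/- Vanishing of odd Frobenius-trace moments of elliptic curves (twist cancellation): let K be a finite field with q elements and for a smooth Weierstrass curve W over K set t_W := q + 1 − #W(K) ∈ ℤ. Then for every odd natural number m, the sum of (t_W)^m over all smooth Weierstrass curves W over K (i.e. over all tuples (a₁,a₂,a₃,a₄,a₆) ∈ K⁵ with Δ(W) ≠ 0) equals 0. (Equivalently, the weighted odd moments σ_m(q) of Frobenius eigenvalues over isomorphism classes of elliptic curves vanish, because the contribution of a curve and its quadratic twist cancel.) -/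
/-- The number of `K`-rational points of a Weierstrass curve `W` over `K`:
the affine solutions `(x, y)` of `y² + a₁xy + a₃y = x³ + a₂x² + a₄x + a₆`
together with a single point at infinity. -/
noncomputable def WeierstrassCurve.ptCount (K : Type*) [Field K] (W : WeierstrassCurve K) : ℕ :=
  1 + Nat.card {P : K × K //
    P.2 ^ 2 + W.a₁ * P.1 * P.2 + W.a₃ * P.2
      = P.1 ^ 3 + W.a₂ * P.1 ^ 2 + W.a₄ * P.1 + W.a₆}

/-- A Weierstrass curve over `K` is just a tuple `(a₁, a₂, a₃, a₄, a₆) ∈ K⁵`. -/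
def weierstrassEquivTuple (K : Type*) [Field K] :
    WeierstrassCurve K ≃ K × K × K × K × K where
  toFun W := (W.a₁, W.a₂, W.a₃, W.a₄, W.a₆)
  invFun v := ⟨v.1, v.2.1, v.2.2.1, v.2.2.2.1, v.2.2.2.2⟩
  left_inv _ := rfl
  right_inv _ := rfl

noncomputable instance (K : Type*) [Field K] [Fintype K] : Fintype (WeierstrassCurve K) :=
  Fintype.ofEquiv _ (weierstrassEquivTuple K).symm

namespace WeierstrassCurve

/-- The number of affine points of `W` with a given `x`-coordinate. -/
noncomputable def fiberCount {K : Type*} [Field K] (W : WeierstrassCurve K) (x : K) : ℕ :=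
  Nat.card {y : K // y ^ 2 + (W.a₁ * x + W.a₃) * y
    = x ^ 3 + W.a₂ * x ^ 2 + W.a₄ * x + W.a₆}

theorem ptCount_eq_one_add_sum {K : Type*} [Field K] [Fintype K] (W : WeierstrassCurve K) :
    ptCount K W = 1 + ∑ x, W.fiberCount x := by
  unfold ptCount fiberCount
  rw [← Nat.card_sigma]
  refine congrArg (1 + ·) (Nat.card_congr ?_)
  refine (Equiv.subtypeEquivRight fun P => ?_).trans
    (Equiv.subtypeProdEquivSigmaSubtype fun x y : K => y ^ 2 + (W.a₁ * x + W.a₃) * y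
      = x ^ 3 + W.a₂ * x ^ 2 + W.a₄ * x + W.a₆)
  rw [add_mul, ← add_assoc]

theorem ptCount_add_ptCount {K : Type*} [Field K] [Fintype K] (W W' : WeierstrassCurve K)
    (e : K ≃ K) (h : ∀ x, W.fiberCount x + W'.fiberCount (e x) = 2) :
    ptCount K W + ptCount K W' = 2 * Fintype.card K + 2 := by
  rw [ptCount_eq_one_add_sum, ptCount_eq_one_add_sum, ← Equiv.sum_comp e W'.fiberCount]
  have hsum : ∑ x, W.fiberCount x + ∑ x, W'.fiberCount (e x) = 2 * Fintype.card K := by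
    rw [← Finset.sum_add_distrib, Finset.sum_congr rfl fun x _ => h x]
    simp [mul_comm]
  omega

end WeierstrassCurve

/-- In odd characteristic the number of roots of a monic quadratic polynomial is governed by the
quadratic character of its discriminant. -/
theorem natCard_quadratic_of_ringChar_ne_two {K : Type*} [Field K] [Fintype K] [DecidableEq K]
    (hK : ringChar K ≠ 2) (h f : K) :
    (Nat.card {y : K // y ^ 2 + h * y = f} : ℤ) = quadraticChar K (h ^ 2 + 4 * f) + 1 := by
  have h2 : (2 : K) ≠ 0 := Ring.two_ne_zero hK
  rw [← quadraticChar_card_sqrts hK, Set.toFinset_card, ← Nat.card_eq_fintype_card]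
  refine congrArg _ (Nat.card_congr ?_)
  refine ((Equiv.mulLeft₀ 2 h2).trans (Equiv.addRight h)).subtypeEquiv fun y => ?_
  simp only [Equiv.trans_apply, Equiv.mulLeft₀_apply, Equiv.coe_addRight, Set.mem_ofPred_eq]
  refine ⟨fun hy => by linear_combination 4 * hy, fun hy => ?_⟩
  refine mul_left_cancel₀ (mul_ne_zero h2 h2) ?_
  linear_combination hy

/-- In characteristic two, the additive map `z ↦ z ^ 2 + z` has image of index two. -/
theorem exists_xor_artinSchreier {K : Type*} [Field K] [Fintype K] [CharP K 2] :
    ∃ c : K, ∀ b : K, Xor (∃ z : K, z ^ 2 + z = b + c) (∃ z : K, z ^ 2 + z = b) := by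
  let φ : K →+ K :=
    { toFun := fun z => z ^ 2 + z
      map_zero' := by ring
      map_add' := fun x y => by linear_combination x * y * CharTwo.two_eq_zero (R := K) }
  have hker : Nat.card φ.ker = 2 := by
    have hset : (φ.ker : Set K) = {0, 1} := by
      ext z
      have hz : z ^ 2 + z = 0 ↔ z = 0 ∨ z = 1 := by
        rw [show z ^ 2 + z = z * (z - 1) by
          linear_combination z * CharTwo.two_eq_zero (R := K), mul_eq_zero, sub_eq_zero]
      exact hz
    rw [← SetLike.coe_sort_coe, hset, Nat.card_coe_set_eq, Set.ncard_pair zero_ne_one]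
  have hindex : φ.range.index = 2 := by
    have h1 := φ.range.card_mul_index
    have h2 := φ.ker.card_mul_index
    rw [AddSubgroup.index_ker, hker, ← h1, mul_comm] at h2
    exact (Nat.eq_of_mul_eq_mul_left Nat.card_pos h2).symm
  exact AddSubgroup.index_eq_two_iff.mp hindex

theorem natCard_artinSchreier {K : Type*} [Field K] [CharP K 2] (b : K)
    [Decidable (∃ z : K, z ^ 2 + z = b)] :
    Nat.card {z : K // z ^ 2 + z = b} = if ∃ z : K, z ^ 2 + z = b then 2 else 0 := by
  split_ifs with hb
  · obtain ⟨z, hz⟩ := hb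
    have hset : {w : K | w ^ 2 + w = b} = {z, z + 1} := by
      ext w
      have hw : w ^ 2 + w - b = (w - z) * (w - (z + 1)) := by
        linear_combination hz + (w + w * z - z ^ 2 - z) * CharTwo.two_eq_zero (R := K)
      rw [Set.mem_ofPred_eq, ← sub_eq_zero, hw, mul_eq_zero, sub_eq_zero, sub_eq_zero]
      rfl
    rw [← Set.coe_ofPred, hset, Nat.card_coe_set_eq, Set.ncard_pair (by simp)]
  · have : IsEmpty {z : K // z ^ 2 + z = b} := ⟨fun z => hb ⟨z.1, z.2⟩⟩
    exact Nat.card_of_isEmpty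

theorem natCard_quadratic_add_natCard_quadratic_of_charTwo {K : Type*} [Field K] [Fintype K]
    [CharP K 2] {c : K}
    (hc : ∀ b : K, Xor (∃ z : K, z ^ 2 + z = b + c) (∃ z : K, z ^ 2 + z = b)) (h f : K) :
    Nat.card {y : K // y ^ 2 + h * y = f} + Nat.card {y : K // y ^ 2 + h * y = f + c * h ^ 2}
      = 2 := by
  classical
  by_cases hh : h = 0
  · subst hh
    have hroot : ∀ g : K, Nat.card {y : K // y ^ 2 = g} = 1 := fun g => by
      obtain ⟨z, hz⟩ := (frobeniusEquiv K 2).surjective g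
      refine Nat.card_eq_one_iff_exists.mpr ⟨⟨z, hz⟩, fun y => Subtype.ext ?_⟩
      exact (frobeniusEquiv K 2).injective (y.2.trans hz.symm)
    simp only [zero_mul, add_zero, ne_eq, OfNat.ofNat_ne_zero, not_false_eq_true, zero_pow,
      mul_zero, hroot]
  · have hscale : ∀ g : K, Nat.card {y : K // y ^ 2 + h * y = g * h ^ 2}
        = Nat.card {z : K // z ^ 2 + z = g} := fun g => by
      refine (Nat.card_congr ((Equiv.mulLeft₀ h hh).subtypeEquiv fun z => ?_)).symm
      rw [Equiv.mulLeft₀_apply, ← mul_left_inj' (pow_ne_zero 2 hh)]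
      exact Eq.congr (by ring) rfl
    obtain ⟨g, rfl⟩ : ∃ g, f = g * h ^ 2 := ⟨f / h ^ 2, by field_simp⟩
    rw [← add_mul, hscale, hscale, natCard_artinSchreier, natCard_artinSchreier]
    rcases hc g with ⟨h1, h2⟩ | ⟨h1, h2⟩ <;> simp [h1, h2]

namespace WeierstrassCurve

/-- The quadratic twist of `W` by `d` in odd characteristic, with `a₁` and `a₃` kept fixed. -/
def kummerTwist {K : Type*} [Field K] (d : K) (W : WeierstrassCurve K) : WeierstrassCurve K where
  a₁ := W.a₁
  a₂ := d * W.a₂ + (d - 1) * W.a₁ ^ 2 / 4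
  a₃ := W.a₃
  a₄ := d ^ 2 * W.a₄ + (d ^ 2 - 1) * (W.a₁ * W.a₃) / 2
  a₆ := d ^ 3 * W.a₆ + (d ^ 3 - 1) * W.a₃ ^ 2 / 4

theorem kummerTwist_injective {K : Type*} [Field K] {d : K} (hd : d ≠ 0) :
    Function.Injective (kummerTwist d) := by
  intro W W' h
  simp only [kummerTwist, WeierstrassCurve.mk.injEq] at h
  obtain ⟨h1, h2, h3, h4, h6⟩ := h
  rw [h1, add_left_inj] at h2
  rw [h1, h3, add_left_inj] at h4
  rw [h3, add_left_inj] at h6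
  exact WeierstrassCurve.ext h1 (mul_left_cancel₀ hd h2) h3
    (mul_left_cancel₀ (pow_ne_zero 2 hd) h4) (mul_left_cancel₀ (pow_ne_zero 3 hd) h6)

theorem Δ_kummerTwist {K : Type*} [Field K] (h2 : (2 : K) ≠ 0) (d : K) (W : WeierstrassCurve K) :
    (W.kummerTwist d).Δ = d ^ 6 * W.Δ := by
  have h4 : (4 : K) ≠ 0 := by
    rw [show (4 : K) = 2 * 2 by norm_num]
    exact mul_ne_zero h2 h2
  simp only [Δ, b₂, b₄, b₆, b₈, kummerTwist]
  field_simp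
  ring

theorem fiberCount_add_fiberCount_kummerTwist {K : Type*} [Field K] [Fintype K] [DecidableEq K]
    (hK : ringChar K ≠ 2) {d : K} (hd : quadraticChar K d = -1) (W : WeierstrassCurve K) (x : K) :
    W.fiberCount x + (W.kummerTwist d).fiberCount (d * x) = 2 := by
  have h2 : (2 : K) ≠ 0 := Ring.two_ne_zero hK
  have h4 : (4 : K) ≠ 0 := by
    rw [show (4 : K) = 2 * 2 by norm_num]
    exact mul_ne_zero h2 h2
  have hdisc : (W.a₁ * (d * x) + W.a₃) ^ 2 + 4 * ((d * x) ^ 3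
      + (d * W.a₂ + (d - 1) * W.a₁ ^ 2 / 4) * (d * x) ^ 2
      + (d ^ 2 * W.a₄ + (d ^ 2 - 1) * (W.a₁ * W.a₃) / 2) * (d * x)
      + (d ^ 3 * W.a₆ + (d ^ 3 - 1) * W.a₃ ^ 2 / 4))
      = d ^ 3 * ((W.a₁ * x + W.a₃) ^ 2 + 4 * (x ^ 3 + W.a₂ * x ^ 2 + W.a₄ * x + W.a₆)) := by
    field_simp
    ring
  zify
  simp only [fiberCount, kummerTwist]
  rw [natCard_quadratic_of_ringChar_ne_two hK, natCard_quadratic_of_ringChar_ne_two hK, hdisc,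
    map_mul, map_pow, hd]
  ring

/-- The quadratic twist of `W` by the Artin–Schreier class of `c` in characteristic two. -/
def artinSchreierTwist {K : Type*} [Field K] (c : K) (W : WeierstrassCurve K) :
    WeierstrassCurve K where
  a₁ := W.a₁
  a₂ := W.a₂ + c * W.a₁ ^ 2
  a₃ := W.a₃
  a₄ := W.a₄
  a₆ := W.a₆ + c * W.a₃ ^ 2

theorem artinSchreierTwist_injective {K : Type*} [Field K] (c : K) :
    Function.Injective (artinSchreierTwist c) := by
  intro W W' h
  simp only [artinSchreierTwist, WeierstrassCurve.mk.injEq] at h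
  obtain ⟨h1, h2, h3, h4, h6⟩ := h
  rw [h1, add_left_inj] at h2
  rw [h3, add_left_inj] at h6
  exact WeierstrassCurve.ext h1 h2 h3 h4 h6

theorem Δ_artinSchreierTwist {K : Type*} [Field K] [CharP K 2] (c : K) (W : WeierstrassCurve K) :
    (W.artinSchreierTwist c).Δ = W.Δ := by
  have h2 := CharTwo.two_eq_zero (R := K)
  have hb₂ : (W.artinSchreierTwist c).b₂ = W.b₂ := by
    simp only [b₂, artinSchreierTwist]
    linear_combination 2 * c * W.a₁ ^ 2 * h2
  have hb₄ : (W.artinSchreierTwist c).b₄ = W.b₄ := rfl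
  have hb₆ : (W.artinSchreierTwist c).b₆ = W.b₆ := by
    simp only [b₆, artinSchreierTwist]
    linear_combination 2 * c * W.a₃ ^ 2 * h2
  have hb₈ : (W.artinSchreierTwist c).b₈ = W.b₈ := by
    simp only [b₈, artinSchreierTwist]
    linear_combination (c * W.a₁ ^ 2 * W.a₃ ^ 2 + 2 * (W.a₂ * c * W.a₃ ^ 2
      + c * W.a₁ ^ 2 * W.a₆ + c ^ 2 * W.a₁ ^ 2 * W.a₃ ^ 2)) * h2
  rw [Δ, Δ, hb₂, hb₄, hb₆, hb₈]

theorem fiberCount_add_fiberCount_artinSchreierTwist {K : Type*} [Field K] [Fintype K]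
    [CharP K 2] {c : K}
    (hc : ∀ b : K, Xor (∃ z : K, z ^ 2 + z = b + c) (∃ z : K, z ^ 2 + z = b))
    (W : WeierstrassCurve K) (x : K) :
    W.fiberCount x + (W.artinSchreierTwist c).fiberCount x = 2 := by
  rw [← natCard_quadratic_add_natCard_quadratic_of_charTwo hc (W.a₁ * x + W.a₃)
    (x ^ 3 + W.a₂ * x ^ 2 + W.a₄ * x + W.a₆)]
  simp only [fiberCount, artinSchreierTwist]
  rw [show x ^ 3 + (W.a₂ + c * W.a₁ ^ 2) * x ^ 2 + W.a₄ * x + (W.a₆ + c * W.a₃ ^ 2)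
    = x ^ 3 + W.a₂ * x ^ 2 + W.a₄ * x + W.a₆ + c * (W.a₁ * x + W.a₃) ^ 2 by
      linear_combination -(c * W.a₁ * W.a₃ * x) * CharTwo.two_eq_zero (R := K)]

/-- Over a finite field, quadratic twisting permutes the smooth Weierstrass curves and negates the
trace of Frobenius. -/
theorem exists_quadraticTwist (K : Type*) [Field K] [Fintype K] :
    ∃ σ : WeierstrassCurve K → WeierstrassCurve K, Function.Injective σ ∧
      (∀ W, (σ W).Δ ≠ 0 ↔ W.Δ ≠ 0) ∧
      ∀ W, ptCount K W + ptCount K (σ W) = 2 * Fintype.card K + 2 := by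
  classical
  by_cases hK : ringChar K = 2
  · have : CharP K 2 := ringChar.of_eq hK
    obtain ⟨c, hc⟩ := exists_xor_artinSchreier (K := K)
    exact ⟨artinSchreierTwist c, artinSchreierTwist_injective c,
      fun W => by rw [Δ_artinSchreierTwist],
      fun W => ptCount_add_ptCount _ _ (Equiv.refl K)
        (fiberCount_add_fiberCount_artinSchreierTwist hc W)⟩
  · obtain ⟨d, hd⟩ := quadraticChar_exists_neg_one hK
    have hd0 : d ≠ 0 := by
      rintro rfl
      simp at hd
    exact ⟨kummerTwist d, kummerTwist_injective hd0,
      fun W => by simp [Δ_kummerTwist (Ring.two_ne_zero hK), hd0],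
      fun W => ptCount_add_ptCount _ _ (Equiv.mulLeft₀ d hd0)
        (fiberCount_add_fiberCount_kummerTwist hK hd W)⟩

end WeierstrassCurve

open scoped Classical in
/-- **Vanishing of odd Frobenius-trace moments of elliptic curves (twist cancellation)**:
over a finite field `K` with `q` elements, for every odd `m` the sum of
`(t_W)^m = (q + 1 − #W(K))^m` over all smooth Weierstrass curves `W` over `K` vanishes. -/
theorem odd_moments_vanish (K : Type*) [Field K] [Fintype K] (q : ℕ)
    (hq : Fintype.card K = q) (m : ℕ) (hm : Odd m) :
    ∑ W ∈ Finset.univ.filter (fun W : WeierstrassCurve K => W.Δ ≠ 0),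
      ((q : ℤ) + 1 - WeierstrassCurve.ptCount K W) ^ m = 0 := by
  subst hq
  obtain ⟨σ, hinj, hΔ, hcount⟩ := WeierstrassCurve.exists_quadraticTwist K
  let e : WeierstrassCurve K ≃ WeierstrassCurve K :=
    Equiv.ofBijective σ (Finite.injective_iff_bijective.mp hinj)
  rw [← self_eq_neg, ← Finset.sum_neg_distrib]
  refine Finset.sum_equiv e (fun W => ?_) fun W _ => ?_
  · rw [Finset.mem_filter_univ, Finset.mem_filter_univ]
    exact (hΔ W).symm
  · rw [← hm.neg_pow]
    have h : (WeierstrassCurve.ptCount K W + WeierstrassCurve.ptCount K (e W) : ℤ)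
      = 2 * Fintype.card K + 2 := mod_cast hcount W
    exact congrArg (· ^ m) (by linear_combination -h)
end

section
/- Even moments of elliptic curves over 𝔽_p in the range without cusp forms: let p be a prime and define integer polynomial functions h₀, h₁, h₂, … by h₀(t) = 1, h₁(t) = t, and h_{n}(t) = t·h_{n−1}(t) − p·h_{n−2}(t) for n ≥ 2 (so that h_a(α+ᾱ) = α^a + α^{a−1}ᾱ + ⋯ + ᾱ^a whenever αᾱ = p). Then for each a ∈ {2, 4, 6, 8}, the sum of h_a(t_W) over all smooth Weierstrass curves W over ℤ/pℤ equals −(p − 1)·p³. (Since the coordinate-change group has order (p−1)p³, this says exactly that the weighted moment σ_a(p) = −Σ_{E/𝔽_p} h_a(α_E + ᾱ_E)/#Aut_{𝔽_p}(E) equals 1, in accordance with the Eichler–Shimura relation σ_a(p) = 1 + Tr(T(p), S_{a+2}(SL(2,ℤ))) and the vanishing of the spaces of cusp forms of weights 4, 6, 8, 10 on SL(2,ℤ).) -/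
/-- The integer polynomial functions `h_n` with `h₀(t) = 1`, `h₁(t) = t` and
`h_n(t) = t·h_{n−1}(t) − p·h_{n−2}(t)`, so that `h_a(α + ᾱ) = α^a + α^(a−1)ᾱ + ⋯ + ᾱ^a`
whenever `αᾱ = p`. -/
def symmPowerPoly (p : ℕ) : ℕ → ℤ → ℤ
  | 0 => fun _ => 1
  | 1 => fun t => t
  | (n + 2) => fun t => t * symmPowerPoly p (n + 1) t - p * symmPowerPoly p n t

open Polynomial

/-- The monic polynomial `X ^ n + ∑ cᵢ X ^ i` with prescribed lower coefficients. -/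
noncomputable def monicOfCoeffs {F : Type*} [Field F] (n : ℕ) (c : Fin n → F) : F[X] :=
  X ^ n + ∑ i, C (c i) * X ^ (i : ℕ)

section Monics

variable {F : Type*} [Field F]

lemma degree_sum_coeffs_lt (n : ℕ) (c : Fin n → F) :
    (∑ i, C (c i) * X ^ (i : ℕ) : F[X]).degree < (n : WithBot ℕ) := by
  refine (degree_sum_le _ _).trans_lt ?_
  rw [Finset.sup_lt_iff (by exact WithBot.bot_lt_coe n)]
  intro i _
  exact (degree_C_mul_X_pow_le _ _).trans_lt (by exact_mod_cast i.2)

lemma monic_monicOfCoeffs (n : ℕ) (c : Fin n → F) : (monicOfCoeffs n c).Monic :=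
  monic_X_pow_add (degree_sum_coeffs_lt n c)

lemma natDegree_monicOfCoeffs (n : ℕ) (c : Fin n → F) : (monicOfCoeffs n c).natDegree = n := by
  refine natDegree_eq_of_degree_eq_some ?_
  rw [monicOfCoeffs, degree_add_eq_left_of_degree_lt, degree_X_pow]
  rw [degree_X_pow]
  exact degree_sum_coeffs_lt n c

lemma coeff_monicOfCoeffs (n : ℕ) (c : Fin n → F) (i : Fin n) :
    (monicOfCoeffs n c).coeff i = c i := by
  simp [monicOfCoeffs, coeff_X_pow, i.2.ne, finsetSum_coeff, Fin.val_inj]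

lemma monicOfCoeffs_injective (n : ℕ) : Function.Injective (monicOfCoeffs (F := F) n) :=
  fun c d h => funext fun i => by rw [← coeff_monicOfCoeffs n c, h, coeff_monicOfCoeffs]

lemma Polynomial.Monic.eq_monicOfCoeffs {A : F[X]} (hA : A.Monic) :
    A = monicOfCoeffs A.natDegree (fun i => A.coeff i) := by
  conv_lhs => rw [hA.as_sum]
  rw [monicOfCoeffs, Fin.sum_univ_eq_sum_range (fun i => C (A.coeff i) * X ^ i)]

lemma map_pow_of_monic {R : Type*} [CommRing R] {χ : F[X] → R} (h1 : χ 1 = 1)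
    (hmul : ∀ A B : F[X], A.Monic → B.Monic → χ (A * B) = χ A * χ B) {P : F[X]} (hP : P.Monic)
    (j : ℕ) : χ (P ^ j) = χ P ^ j := by
  induction j with
  | zero => simp [h1]
  | succ j ih => rw [pow_succ, pow_succ, hmul _ _ (hP.pow j) hP, ih]

variable [Fintype F]

open scoped Classical in
/-- The finite set of monic polynomials of degree `n` over a finite field. -/
noncomputable def monics (F : Type*) [Field F] [Fintype F] (n : ℕ) : Finset F[X] :=
  Finset.univ.image (monicOfCoeffs n)

lemma mem_monics {n : ℕ} {A : F[X]} : A ∈ monics F n ↔ A.Monic ∧ A.natDegree = n := by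
  classical
  simp only [monics, Finset.mem_image, Finset.mem_univ, true_and]
  constructor
  · rintro ⟨c, rfl⟩
    exact ⟨monic_monicOfCoeffs n c, natDegree_monicOfCoeffs n c⟩
  · rintro ⟨h, rfl⟩
    exact ⟨_, h.eq_monicOfCoeffs.symm⟩

lemma sum_monics {R : Type*} [AddCommMonoid R] (n : ℕ) (f : F[X] → R) :
    ∑ A ∈ monics F n, f A = ∑ c : Fin n → F, f (monicOfCoeffs n c) := by
  classical
  rw [monics, Finset.sum_image fun c _ d _ h => monicOfCoeffs_injective n h]

lemma sum_monics_zero {R : Type*} [AddCommMonoid R] (f : F[X] → R) :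
    ∑ A ∈ monics F 0, f A = f 1 := by
  rw [sum_monics, Fintype.sum_unique, monicOfCoeffs]
  simp

lemma sum_monics_one {R : Type*} [AddCommMonoid R] (f : F[X] → R) :
    ∑ A ∈ monics F 1, f A = ∑ r : F, f (X - C r) := by
  rw [sum_monics]
  refine Fintype.sum_equiv ((Equiv.funUnique (Fin 1) F).trans (Equiv.neg F)) _ _ fun c => ?_
  simp [monicOfCoeffs]

open scoped Classical in
/-- The finite set of monic irreducible polynomials of degree `n` over a finite field. -/
noncomputable def monicIrreducibles (F : Type*) [Field F] [Fintype F] (n : ℕ) : Finset F[X] :=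
  (monics F n).filter Irreducible

lemma mem_monicIrreducibles {n : ℕ} {A : F[X]} :
    A ∈ monicIrreducibles F n ↔ (A.Monic ∧ A.natDegree = n) ∧ Irreducible A := by
  simp [monicIrreducibles, mem_monics]

open scoped Classical in
lemma natDegree_eq_sum_pow_dvd {n : ℕ} {A : F[X]} (hA : A ∈ monics F n) :
    n = ∑ d ∈ Finset.Icc 1 n, ∑ P ∈ monicIrreducibles F d, ∑ j ∈ Finset.Icc 1 n,
      if P ^ j ∣ A then d else 0 := by
  obtain ⟨hm, hn⟩ := mem_monics.1 hA
  have hA0 : A ≠ 0 := hm.ne_zero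
  have key : ∀ d ∈ Finset.Icc 1 n, ∀ P ∈ monicIrreducibles F d,
      (∑ j ∈ Finset.Icc 1 n, if P ^ j ∣ A then d else 0)
        = (UniqueFactorizationMonoid.normalizedFactors A).count P * d := by
    intro d hd P hP
    obtain ⟨⟨hPm, hPd⟩, hPi⟩ := mem_monicIrreducibles.1 hP
    have hc : ∀ j, P ^ j ∣ A ↔ j ≤ (UniqueFactorizationMonoid.normalizedFactors A).count P := by
      intro j
      have := UniqueFactorizationMonoid.emultiplicity_eq_count_normalizedFactors hPi hA0
      rw [hPm.normalize_eq_self] at this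
      rw [pow_dvd_iff_le_emultiplicity, this]
      exact_mod_cast Iff.rfl
    rw [← Finset.sum_filter, Finset.sum_const, smul_eq_mul]
    congr 1
    have hle : (UniqueFactorizationMonoid.normalizedFactors A).count P ≤ n := by
      have h1 := natDegree_le_of_dvd ((hc _).2 le_rfl) hA0
      rw [hPm.natDegree_pow, hPd, hn] at h1
      exact (Nat.le_mul_of_pos_right _ (Finset.mem_Icc.1 hd).1).trans h1
    have : (Finset.Icc 1 n).filter (fun j => P ^ j ∣ A)
        = Finset.Icc 1 ((UniqueFactorizationMonoid.normalizedFactors A).count P) := by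
      ext j
      simp only [Finset.mem_filter, Finset.mem_Icc, hc]
      omega
    rw [this, Nat.card_Icc]
    omega
  rw [Finset.sum_congr rfl fun d hd => Finset.sum_congr rfl (key d hd)]
  have hprod : (UniqueFactorizationMonoid.normalizedFactors A).prod = A := by
    rw [UniqueFactorizationMonoid.prod_normalizedFactors_eq hA0, hm.normalize_eq_self]
  have hfac : ∀ P ∈ UniqueFactorizationMonoid.normalizedFactors A,
      P.natDegree ∈ Finset.Icc 1 n ∧ P ∈ monicIrreducibles F P.natDegree := by
    intro P hP
    have hPi := UniqueFactorizationMonoid.irreducible_of_normalized_factor P hP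
    have hPn := UniqueFactorizationMonoid.normalize_normalized_factor P hP
    have hPm : P.Monic := by rw [← hPn]; exact monic_normalize hPi.ne_zero
    have hle := natDegree_le_of_dvd (UniqueFactorizationMonoid.dvd_of_mem_normalizedFactors hP) hA0
    exact ⟨Finset.mem_Icc.2 ⟨hPi.natDegree_pos, hn ▸ hle⟩,
      mem_monicIrreducibles.2 ⟨⟨hPm, rfl⟩, hPi⟩⟩
  have hdeg : n = ((UniqueFactorizationMonoid.normalizedFactors A).map natDegree).sum := by
    conv_lhs => rw [← hn, ← hprod]
    exact natDegree_multiset_prod _ (UniqueFactorizationMonoid.zero_notMem_normalizedFactors A)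
  conv_lhs => rw [hdeg]
  rw [Finset.sum_multiset_map_count]
  rw [← Finset.sum_fiberwise_of_maps_to (t := Finset.Icc 1 n) (g := natDegree)
    (fun P hP => (hfac P (Multiset.mem_toFinset.1 hP)).1)]
  refine Finset.sum_congr rfl fun d _ => ?_
  refine Finset.sum_subset_zero_on_sdiff ?_ ?_ ?_
  · intro P hP
    obtain ⟨h1, rfl⟩ := Finset.mem_filter.1 hP
    exact (hfac P (Multiset.mem_toFinset.1 h1)).2
  · intro P hP
    obtain ⟨h1, h2⟩ := Finset.mem_sdiff.1 hP
    rw [Multiset.count_eq_zero_of_notMem, zero_mul]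
    intro h3
    exact h2 (Finset.mem_filter.2 ⟨Multiset.mem_toFinset.2 h3, (mem_monicIrreducibles.1 h1).1.2⟩)
  · intro P hP
    rw [(Finset.mem_filter.1 hP).2, smul_eq_mul]

variable {R : Type*} [CommRing R]

/-- The sum of `χ` over monic polynomials of degree `n`: a coefficient of the `L`-series of `χ`. -/
noncomputable def lCoeff (χ : F[X] → R) (n : ℕ) : R := ∑ A ∈ monics F n, χ A

/-- The von Mangoldt sum of `χ` in degree `k`, the sum of `deg P * χ P ^ j` over prime powers
`P ^ j` of degree `k`. -/
noncomputable def mangoldtSum (χ : F[X] → R) (k : ℕ) : R :=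
  ∑ x ∈ k.divisorsAntidiagonal, (x.1 : R) * ∑ P ∈ monicIrreducibles F x.1, χ P ^ x.2

open scoped Classical in
lemma sum_monics_dvd {χ : F[X] → R}
    (hmul : ∀ A B : F[X], A.Monic → B.Monic → χ (A * B) = χ A * χ B) {B : F[X]} (hB : B.Monic)
    (n : ℕ) : ∑ A ∈ monics F n, (if B ∣ A then χ A else 0)
      = if B.natDegree ≤ n then χ B * lCoeff χ (n - B.natDegree) else 0 := by
  split_ifs with h
  · rw [← Finset.sum_filter, lCoeff, Finset.mul_sum]
    symm
    refine Finset.sum_bij (fun C _ => B * C) ?_ ?_ ?_ ?_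
    · intro C hC
      obtain ⟨hCm, hCd⟩ := mem_monics.1 hC
      refine Finset.mem_filter.2 ⟨mem_monics.2 ⟨hB.mul hCm, ?_⟩, dvd_mul_right _ _⟩
      rw [hB.natDegree_mul hCm, hCd]
      omega
    · intro C _ D _ h
      exact mul_left_cancel₀ hB.ne_zero h
    · intro A hA
      obtain ⟨hA, C, rfl⟩ := Finset.mem_filter.1 hA
      obtain ⟨hm, hd⟩ := mem_monics.1 hA
      have hC : C.Monic := hB.of_mul_monic_left hm
      refine ⟨C, mem_monics.2 ⟨hC, ?_⟩, rfl⟩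
      rw [hB.natDegree_mul hC] at hd
      omega
    · intro C hC
      exact (hmul _ _ hB (mem_monics.1 hC).1).symm
  · refine Finset.sum_eq_zero fun A hA => if_neg fun hd => h ?_
    obtain ⟨hm, rfl⟩ := mem_monics.1 hA
    exact natDegree_le_of_dvd hd hm.ne_zero

/-- The Newton-type identity obtained from the logarithmic derivative of the Euler product. -/
theorem natCast_mul_lCoeff {χ : F[X] → R} (h1 : χ 1 = 1)
    (hmul : ∀ A B : F[X], A.Monic → B.Monic → χ (A * B) = χ A * χ B) (n : ℕ) :
    (n : R) * lCoeff χ n = ∑ k ∈ Finset.Icc 1 n, mangoldtSum χ k * lCoeff χ (n - k) := by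
  classical
  have lhs : (n : R) * lCoeff χ n = ∑ d ∈ Finset.Icc 1 n, ∑ j ∈ Finset.Icc 1 n,
      if d * j ≤ n then (d : R) * (∑ P ∈ monicIrreducibles F d, χ P ^ j) * lCoeff χ (n - d * j)
        else 0 := by
    have step : ∀ A ∈ monics F n, (n : R) * χ A = ∑ d ∈ Finset.Icc 1 n, ∑ j ∈ Finset.Icc 1 n,
        ∑ P ∈ monicIrreducibles F d, (d : R) * if P ^ j ∣ A then χ A else 0 := by
      intro A hA
      have := congrArg (Nat.cast : ℕ → R) (natDegree_eq_sum_pow_dvd hA)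
      rw [this]
      push_cast
      rw [Finset.sum_mul]
      refine Finset.sum_congr rfl fun d _ => ?_
      rw [Finset.sum_comm, Finset.sum_mul]
      refine Finset.sum_congr rfl fun j _ => ?_
      rw [Finset.sum_mul]
      refine Finset.sum_congr rfl fun P _ => ?_
      split_ifs <;> simp
    rw [lCoeff, Finset.mul_sum, Finset.sum_congr rfl step, Finset.sum_comm]
    refine Finset.sum_congr rfl fun d _ => ?_
    rw [Finset.sum_comm]
    refine Finset.sum_congr rfl fun j _ => ?_
    rw [Finset.sum_comm]
    have : ∀ P ∈ monicIrreducibles F d,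
        ∑ A ∈ monics F n, ((d : R) * if P ^ j ∣ A then χ A else 0)
          = if d * j ≤ n then (d : R) * (χ P ^ j * lCoeff χ (n - d * j)) else 0 := by
      intro P hP
      obtain ⟨⟨hPm, hPd⟩, -⟩ := mem_monicIrreducibles.1 hP
      rw [← Finset.mul_sum, sum_monics_dvd hmul (hPm.pow j), hPm.natDegree_pow, hPd, mul_comm j d,
        map_pow_of_monic h1 hmul hPm]
      split_ifs <;> simp
    rw [Finset.sum_congr rfl this]
    split_ifs
    · rw [Finset.mul_sum, Finset.sum_mul]
      exact Finset.sum_congr rfl fun P _ => by ring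
    · simp
  rw [lhs, ← Finset.sum_product', ← Finset.sum_filter,
    ← Finset.sum_fiberwise_of_maps_to (t := Finset.Icc 1 n) (g := fun x : ℕ × ℕ => x.1 * x.2)]
  · refine Finset.sum_congr rfl fun k hk => ?_
    rw [mangoldtSum, Finset.sum_mul]
    have hk' := Finset.mem_Icc.1 hk
    refine Finset.sum_congr ?_ ?_
    · ext ⟨d, j⟩
      simp only [Finset.mem_filter, Finset.mem_product, Finset.mem_Icc,
        Nat.mem_divisorsAntidiagonal]
      constructor
      · rintro ⟨_, h⟩
        exact ⟨h, by omega⟩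
      · rintro ⟨rfl, h⟩
        have hd : 0 < d := Nat.pos_of_ne_zero (by rintro rfl; simp at h)
        have hj : 0 < j := Nat.pos_of_ne_zero (by rintro rfl; simp at h)
        refine ⟨⟨⟨⟨hd, ?_⟩, ⟨hj, ?_⟩⟩, hk'.2⟩, rfl⟩
        · exact (Nat.le_mul_of_pos_right d hj).trans hk'.2
        · exact (Nat.le_mul_of_pos_left j hd).trans hk'.2
    · rintro ⟨d, j⟩ hx
      rw [(Nat.mem_divisorsAntidiagonal.1 hx).1]
  · rintro ⟨d, j⟩ hx
    simp only [Finset.mem_filter, Finset.mem_product, Finset.mem_Icc] at hx ⊢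
    exact ⟨Nat.mul_pos hx.1.1.1 hx.1.2.1, hx.2⟩

end Monics

section PrimeDegree

variable {F : Type*} [Field F] {K : Type*} [Field K] [Fintype K] [Algebra F K]

lemma natDegree_minpoly_of_notMem_range {k : ℕ} (hk : k.Prime) (hfin : Module.finrank F K = k)
    {x : K} (hx : x ∉ (algebraMap F K).range) : (minpoly F x).natDegree = k := by
  have h := minpoly.degree_dvd (K := F) (Algebra.IsIntegral.isIntegral (R := F) x)
  rw [hfin] at h
  refine (hk.eq_one_or_self_of_dvd _ h).resolve_left fun h1 => hx ?_
  exact minpoly.natDegree_eq_one_iff.1 h1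

variable [Fintype F]

lemma monicIrreducibles_one : monicIrreducibles F 1 = monics F 1 := by
  ext A
  rw [mem_monicIrreducibles, mem_monics, and_iff_left_iff_imp]
  rintro ⟨hm, hd⟩
  exact irreducible_of_degree_eq_one ((degree_eq_iff_natDegree_eq_of_pos one_pos).2 hd)

open scoped Classical in
lemma card_filter_minpoly_eq {k : ℕ} (hfin : Module.finrank F K = k) {P : F[X]}
    (hP : P ∈ monicIrreducibles F k) :
    (Finset.univ.filter fun x : K => minpoly F x = P).card = k := by
  obtain ⟨⟨hm, hd⟩, hi⟩ := mem_monicIrreducibles.1 hP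
  have : Fact (Irreducible P) := ⟨hi⟩
  have hfr : Module.finrank F (AdjoinRoot P) = k := by
    rw [← hd]; exact (AdjoinRoot.powerBasis hi.ne_zero).finrank
  obtain ⟨φ⟩ := FiniteField.nonempty_algHom_of_finrank_dvd (F := F) (K := AdjoinRoot P) (L := K)
    (by rw [hfr, hfin])
  have hroot : aeval (φ (AdjoinRoot.root P)) P = 0 := by
    rw [aeval_algHom_apply, AdjoinRoot.aeval_eq, AdjoinRoot.mk_self, map_zero]
  have hmin : minpoly F (φ (AdjoinRoot.root P)) = P :=
    (minpoly.eq_of_irreducible_of_monic hi hroot hm).symm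
  have hspl : (P.map (algebraMap F K)).Splits := by
    rw [← hmin]; exact Normal.splits inferInstance _
  have hc := card_rootSet_eq_natDegree (PerfectField.separable_of_irreducible hi) hspl
  rw [hd] at hc
  rw [← hc, ← Set.toFinset_card]
  congr 1
  ext x
  simp only [Finset.mem_filter, Finset.mem_univ, true_and, Set.mem_toFinset,
    mem_rootSet_of_ne hi.ne_zero]
  constructor
  · rintro rfl
    exact minpoly.aeval F x
  · exact fun h => (minpoly.eq_of_irreducible_of_monic hi h hm).symm

/-- Elements of an extension of prime degree, sorted by minimal polynomial. -/
theorem mangoldtSum_eq_sum {R : Type*} [CommRing R] {k : ℕ} (hk : k.Prime)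
    (hfin : Module.finrank F K = k) (χ : F[X] → R) (f : K → R)
    (hF : ∀ r : F, f (algebraMap F K r) = χ (X - C r) ^ k)
    (hK : ∀ x ∉ (algebraMap F K).range, f x = χ (minpoly F x)) :
    mangoldtSum χ k = ∑ x, f x := by
  classical
  have hdiv : k.divisorsAntidiagonal = {(1, k), (k, 1)} := by
    rw [← Nat.map_div_right_divisors, hk.divisors, Finset.map_insert, Finset.map_singleton]
    change ({(1, k / 1), (k, k / k)} : Finset (ℕ × ℕ)) = _
    rw [Nat.div_one, Nat.div_self hk.pos]
  rw [mangoldtSum, hdiv, Finset.sum_pair (by simp [hk.one_lt.ne])]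
  rw [← Finset.sum_filter_add_sum_filter_not _ (fun x : K => x ∈ (algebraMap F K).range)]
  congr 1
  · rw [monicIrreducibles_one, sum_monics_one, Nat.cast_one, one_mul]
    refine Finset.sum_bij (fun r _ => algebraMap F K r) ?_ ?_ ?_ ?_
    · intro r _; simp
    · intro r _ s _ h; exact (algebraMap F K).injective h
    · intro x hx
      obtain ⟨r, rfl⟩ := (Finset.mem_filter.1 hx).2
      exact ⟨r, Finset.mem_univ _, rfl⟩
    · intro r _; exact (hF r).symm
  · rw [← Finset.sum_fiberwise_of_maps_to (s := Finset.univ.filter fun x : K => _)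
      (t := monicIrreducibles F k) (g := fun x => minpoly F x)]
    · rw [Finset.mul_sum]
      refine Finset.sum_congr rfl fun P hP => ?_
      obtain ⟨⟨hm, hd⟩, hi⟩ := mem_monicIrreducibles.1 hP
      have hfil : ((Finset.univ.filter fun x : K => x ∉ (algebraMap F K).range).filter
          fun x => minpoly F x = P) = Finset.univ.filter fun x : K => minpoly F x = P := by
        ext x
        simp only [Finset.mem_filter, Finset.mem_univ, true_and, and_iff_right_iff_imp]
        rintro rfl hx
        rw [minpoly.natDegree_eq_one_iff.2 hx] at hd
        exact hk.one_lt.ne hd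
      rw [Finset.sum_congr hfil (g := fun _ => χ P), Finset.sum_const, card_filter_minpoly_eq hfin hP,
        nsmul_eq_mul, pow_one]
      intro x hx
      have := (Finset.mem_filter.1 hx).2
      rw [hK x, this]
      rintro hx
      rw [← this, minpoly.natDegree_eq_one_iff.2 hx] at hd
      exact hk.one_lt.ne hd
    · intro x hx
      have hx := (Finset.mem_filter.1 hx).2
      have hxint := Algebra.IsIntegral.isIntegral (R := F) x
      exact mem_monicIrreducibles.2 ⟨⟨minpoly.monic hxint,
        natDegree_minpoly_of_notMem_range hk hfin hx⟩, minpoly.irreducible hxint⟩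

end PrimeDegree

section QuadraticChar

lemma ringChar_eq_of_algebra {F K : Type*} [Field F] [Field K] [Algebra F K] : ringChar K = ringChar F := by
  have := charP_of_injective_algebraMap (algebraMap F K).injective (ringChar F)
  exact ringChar.eq K (ringChar F)

variable {F : Type*} [Field F] [Fintype F] [DecidableEq F]
  {K : Type*} [Field K] [Fintype K] [DecidableEq K] [Algebra F K]

/-- The quadratic character of an extension is the norm pulled back character of the base. -/
theorem quadraticChar_norm (hF : ringChar F ≠ 2) (z : K) :
    quadraticChar F (Algebra.norm F z) = quadraticChar K z := by
  have hK : ringChar K ≠ 2 := by rwa [ringChar_eq_of_algebra (F := F)]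
  by_cases hz : z = 0
  · subst hz
    rw [Algebra.norm_zero, MulChar.map_zero, MulChar.map_zero]
  have hn : Algebra.norm F z ≠ 0 := Algebra.norm_ne_zero_iff.2 hz
  have h1 := quadraticChar_eq_pow_of_char_ne_two' hF (Algebra.norm F z)
  have h2 := quadraticChar_eq_pow_of_char_ne_two' hK z
  have hpow := FiniteField.algebraMap_norm_eq_pow (K := F) (K' := K) (x := z)
  have key : (quadraticChar F (Algebra.norm F z) : K) = (quadraticChar K z : K) := by
    have h3 := congrArg (algebraMap F K) h1
    rw [map_intCast, map_pow, hpow, ← pow_mul] at h3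
    rw [h3, h2]
    congr 1
    rw [← Fintype.card_eq_nat_card, ← Fintype.card_eq_nat_card]
    obtain ⟨m, hm⟩ : Odd (Fintype.card F) := Nat.odd_iff.2 (FiniteField.odd_card_of_char_ne_two hF)
    have hm0 : 0 < m := by
      have := Fintype.one_lt_card (α := F)
      omega
    have hcard : Fintype.card K = Fintype.card F ^ Module.finrank F K := Module.card_eq_pow_finrank
    obtain ⟨e, he⟩ : Fintype.card F - 1 ∣ Fintype.card K - 1 := by
      rw [hcard]; simpa using Nat.sub_dvd_pow_sub_pow (Fintype.card F) 1 (Module.finrank F K)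
    have hK1 := Fintype.one_lt_card (α := K)
    have h4 : Fintype.card F - 1 = 2 * m := by omega
    rw [he, h4, Nat.mul_div_cancel_left _ (by omega)]
    rw [h4, mul_assoc] at he
    have h5 : Fintype.card K / 2 = m * e := by omega
    rw [h5, hm, mul_comm]
    congr 1
    omega
  rcases quadraticChar_dichotomy hn with a | a <;> rcases quadraticChar_dichotomy hz with b | b <;>
    rw [a, b] at key ⊢
  all_goals
    exfalso
    push_cast at key
    first
    | exact Ring.neg_one_ne_one_of_char_ne_two hK key
    | exact Ring.neg_one_ne_one_of_char_ne_two hK key.symm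

lemma quadraticChar_algebraMap (hF : ringChar F ≠ 2) (hodd : Odd (Module.finrank F K)) (y : F) :
    quadraticChar K (algebraMap F K y) = quadraticChar F y := by
  rw [← quadraticChar_norm hF, Algebra.norm_algebraMap, map_pow]
  by_cases hy : y = 0
  · subst hy; simp [hodd.pos.ne']
  rcases quadraticChar_dichotomy hy with a | a <;> rw [a]
  · simp
  · exact hodd.neg_one_pow

end QuadraticChar

section FrobeniusConjugates

variable {F : Type*} [Field F] [Fintype F] {K : Type*} [Field K] [Fintype K] [Algebra F K]

/-- In an extension of prime degree, the minimal polynomial of a generator splits over its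
Frobenius conjugates. -/
lemma minpoly_map_eq_prod {k : ℕ} (hk : k.Prime) (hfin : Module.finrank F K = k)
    {x : K} (hx : x ∉ (algebraMap F K).range) :
    (minpoly F x).map (algebraMap F K)
      = ∏ i ∈ Finset.range k, (X - C (x ^ Fintype.card F ^ i)) := by
  classical
  have hxint := Algebra.IsIntegral.isIntegral (R := F) x
  have hirr := minpoly.irreducible hxint
  have hspl : ((minpoly F x).map (algebraMap F K)).Splits := Normal.splits inferInstance _
  have hdeg := natDegree_minpoly_of_notMem_range hk hfin hx
  have hroots : ((minpoly F x).map (algebraMap F K)).roots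
      = (Multiset.range k).map fun i => x ^ Fintype.card F ^ i := by
    refine Multiset.eq_of_le_of_card_le ?_ ?_
    · rw [Multiset.le_iff_subset
        (nodup_roots (PerfectField.separable_of_irreducible hirr).map)]
      intro y hy
      rw [mem_roots (((minpoly.monic hxint).map _).ne_zero), IsRoot.def, eval_map_algebraMap] at hy
      obtain ⟨σ, hσ⟩ := minpoly.exists_algEquiv_of_root (Algebra.IsAlgebraic.isAlgebraic x) hy
      obtain ⟨i, hi⟩ := (FiniteField.bijective_frobeniusAlgEquivOfAlgebraic_pow F K).2 σ.symm
      refine Multiset.mem_map.2 ⟨i, Multiset.mem_range.2 (hfin ▸ i.2), ?_⟩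
      rw [← (AlgEquiv.symm_apply_eq σ).2 hσ.symm, ← hi]
      change _ = (FiniteField.frobeniusAlgEquivOfAlgebraic F K ^ (i : ℕ)) x
      rw [AlgEquiv.coe_pow, FiniteField.coe_frobeniusAlgEquivOfAlgebraic_iterate]
    · rw [← hspl.natDegree_eq_card_roots, natDegree_map, hdeg]
      simp
  rw [hspl.eq_prod_roots_of_monic ((minpoly.monic hxint).map _), hroots, Multiset.map_map]
  rfl

lemma aeval_pow_card_pow (h : F[X]) (x : K) (i : ℕ) :
    aeval (x ^ Fintype.card F ^ i) h = aeval x h ^ Fintype.card F ^ i := by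
  have hc : ∀ y : K, y ^ Fintype.card F ^ i
      = (FiniteField.frobeniusAlgEquivOfAlgebraic F K ^ i : Gal(K/F)) y := by
    intro y
    rw [AlgEquiv.coe_pow, FiniteField.coe_frobeniusAlgEquivOfAlgebraic_iterate]
  rw [hc, hc]
  exact aeval_algHom_apply (FiniteField.frobeniusAlgEquivOfAlgebraic F K ^ i : Gal(K/F)) x h

/-- The resultant with a minimal polynomial is a norm. -/
lemma resultant_minpoly {k : ℕ} (hk : k.Prime) (hfin : Module.finrank F K = k)
    {x : K} (hx : x ∉ (algebraMap F K).range) (h : F[X]) {n : ℕ} (hn : h.natDegree ≤ n) :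
    (minpoly F x).resultant h (minpoly F x).natDegree n = Algebra.norm F (aeval x h) := by
  have hxint := Algebra.IsIntegral.isIntegral (R := F) x
  have hspl : ((minpoly F x).map (algebraMap F K)).Splits := Normal.splits inferInstance _
  apply (algebraMap F K).injective
  rw [FiniteField.algebraMap_norm_eq_prod_pow, ← resultant_map_map,
    ← natDegree_map (algebraMap F K) (p := minpoly F x), resultant_eq_prod_eval _ _ _
      (natDegree_map_le.trans hn) hspl, ((minpoly.monic hxint).map _).leadingCoeff, one_pow, one_mul,
      minpoly_map_eq_prod hk hfin hx, hfin]
  have := roots_multiset_prod_X_sub_C ((Multiset.range k).map fun i => x ^ Fintype.card F ^ i)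
  rw [Multiset.map_map] at this
  rw [show ∏ i ∈ Finset.range k, (X - C (x ^ Fintype.card F ^ i)) =
    ((Multiset.range k).map ((fun a : K => X - C a) ∘ fun i => x ^ Fintype.card F ^ i)).prod from rfl]
  rw [this, Multiset.map_map]
  change ∏ i ∈ Finset.range k, _ = _
  refine Finset.prod_congr rfl fun i _ => ?_
  rw [Function.comp_apply, eval_map_algebraMap, aeval_pow_card_pow, Fintype.card_eq_nat_card]

end FrobeniusConjugates

section QuadraticPolynomials

lemma X_sub_C_mul_eq_iff {F : Type*} [Field F] {a b r s : F} :
    (X - C r) * (X - C s) = (X - C a) * (X - C b) ↔ (r = a ∧ s = b) ∨ (r = b ∧ s = a) := by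
  constructor
  · intro h
    have h0 := congrArg (eval 0) h
    have h1 := congrArg (eval 1) h
    have hr := congrArg (eval r) h
    simp only [eval_mul, eval_sub, eval_X, eval_C, sub_self, zero_mul] at h0 h1 hr
    rcases mul_eq_zero.1 hr.symm with h2 | h2
    · exact Or.inl ⟨by linear_combination h2, by linear_combination h0 - h1 - h2⟩
    · exact Or.inr ⟨by linear_combination h2, by linear_combination h0 - h1 - h2⟩
  · rintro (⟨rfl, rfl⟩ | ⟨rfl, rfl⟩)
    · rfl
    · ring

variable {F : Type*} [Field F] [Fintype F] {K : Type*} [Field K] [Fintype K] [Algebra F K]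

open scoped Classical in
lemma card_quadratic_parametrizations (hfin : Module.finrank F K = 2) {A : F[X]}
    (hA : A ∈ monics F 2) :
    (Finset.univ.filter fun x : K => x ∉ (algebraMap F K).range ∧ minpoly F x = A).card
      + (Finset.univ.filter fun x : F × F => (X - C x.1) * (X - C x.2) = A).card
      + (Finset.univ.filter fun r : F => (X - C r) * (X - C r) = A).card = 2 := by
  obtain ⟨hm, hd⟩ := mem_monics.1 hA
  by_cases hi : Irreducible A
  · have h1 : (Finset.univ.filter fun x : K => x ∉ (algebraMap F K).range ∧ minpoly F x = A)
        = Finset.univ.filter fun x : K => minpoly F x = A := by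
      ext x
      simp only [Finset.mem_filter, Finset.mem_univ, true_and, and_iff_right_iff_imp]
      rintro rfl hx
      rw [minpoly.natDegree_eq_one_iff.2 hx] at hd
      omega
    have h2 : ∀ r s : F, (X - C r) * (X - C s) ≠ A := by
      rintro r s rfl
      exact (irreducible_mul_iff.1 hi).elim (fun h => not_isUnit_X_sub_C s h.2)
        (fun h => not_isUnit_X_sub_C r h.2)
    rw [h1, card_filter_minpoly_eq hfin (mem_monicIrreducibles.2 ⟨⟨hm, hd⟩, hi⟩),
      Finset.filter_false_of_mem (fun x _ => h2 _ _), Finset.filter_false_of_mem (fun x _ => h2 _ _)]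
    rfl
  · have hab : ∃ a b : F, A = (X - C a) * (X - C b) := by
      rw [hm.irreducible_iff_natDegree' ] at hi
      push Not at hi
      obtain ⟨f, g, hf, hg, rfl, hmem⟩ := hi (by rintro rfl; simp at hd)
      rw [hf.natDegree_mul hg] at hd
      simp only [Finset.mem_Ioc] at hmem
      rw [hf.natDegree_mul hg] at hmem
      have hf1 : f.natDegree = 1 := by omega
      have hg1 : g.natDegree = 1 := by omega
      refine ⟨-f.coeff 0, -g.coeff 0, ?_⟩
      rw [C_neg, C_neg, sub_neg_eq_add, sub_neg_eq_add, ← hf.eq_X_add_C hf1, ← hg.eq_X_add_C hg1]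
    obtain ⟨a, b, rfl⟩ := hab
    rw [Finset.filter_false_of_mem (s := (Finset.univ : Finset K)), Finset.card_empty, zero_add]
    · simp only [X_sub_C_mul_eq_iff]
      by_cases h : a = b
      · subst h
        have e1 : (Finset.univ.filter fun x : F × F => x.1 = a ∧ x.2 = a ∨ x.1 = a ∧ x.2 = a)
            = {(a, a)} := by
          ext ⟨r, s⟩; simp
        have e2 : (Finset.univ.filter fun r : F => r = a ∧ r = a ∨ r = a ∧ r = a) = {a} := by
          ext r; simp
        rw [e1, e2]
        rfl
      · have e1 : (Finset.univ.filter fun x : F × F => x.1 = a ∧ x.2 = b ∨ x.1 = b ∧ x.2 = a)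
            = {(a, b), (b, a)} := by
          ext ⟨r, s⟩; simp
        have e2 : (Finset.univ.filter fun r : F => r = a ∧ r = b ∨ r = b ∧ r = a) = ∅ := by
          ext r
          simp only [Finset.mem_filter, Finset.mem_univ, true_and, Finset.notMem_empty, iff_false]
          rintro (⟨h1, h2⟩ | ⟨h1, h2⟩)
          · exact h (h1.symm.trans h2)
          · exact h (h2.symm.trans h1)
        rw [e1, e2, Finset.card_pair (by simp [h])]
        rfl
    · rintro x - ⟨-, hx⟩
      refine hi ?_
      rw [← hx]
      exact minpoly.irreducible (Algebra.IsIntegral.isIntegral x)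

open scoped Classical in
/-- Summation over monic quadratics by means of their roots. -/
lemma two_mul_sum_monics_two (hfin : Module.finrank F K = 2) (g : F[X] → ℤ) :
    2 * ∑ A ∈ monics F 2, g A
      = ∑ x ∈ Finset.univ.filter (fun x : K => x ∉ (algebraMap F K).range), g (minpoly F x)
        + ∑ r : F, ∑ s : F, g ((X - C r) * (X - C s)) + ∑ r : F, g ((X - C r) * (X - C r)) := by
  have hmem : ∀ r s : F, (X - C r) * (X - C s) ∈ monics F 2 := fun r s =>
    mem_monics.2 ⟨(monic_X_sub_C r).mul (monic_X_sub_C s), by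
      rw [(monic_X_sub_C r).natDegree_mul (monic_X_sub_C s), natDegree_X_sub_C, natDegree_X_sub_C]⟩
  rw [← Finset.sum_fiberwise_of_maps_to (s := Finset.univ.filter fun x : K => _)
      (t := monics F 2) (g := fun x => minpoly F x),
    ← Fintype.sum_prod_type',
    ← Finset.sum_fiberwise_of_maps_to (s := (Finset.univ : Finset (F × F)))
      (t := monics F 2) (g := fun x => (X - C x.1) * (X - C x.2)) fun x _ => hmem _ _,
    ← Finset.sum_fiberwise_of_maps_to (s := (Finset.univ : Finset F))
      (t := monics F 2) (g := fun r => (X - C r) * (X - C r)) fun x _ => hmem _ _,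
    ← Finset.sum_add_distrib, ← Finset.sum_add_distrib, Finset.mul_sum]
  · refine Finset.sum_congr rfl fun A hA => ?_
    have h1 := card_quadratic_parametrizations (K := K) hfin hA
    rw [Finset.sum_congr rfl fun x hx => by rw [(Finset.mem_filter.1 hx).2],
      Finset.sum_congr (s₁ := Finset.univ.filter fun x : F × F => _) rfl
        fun x hx => by rw [(Finset.mem_filter.1 hx).2],
      Finset.sum_congr (s₁ := Finset.univ.filter fun x : F => _) rfl
        fun x hx => by rw [(Finset.mem_filter.1 hx).2],
      Finset.sum_const, Finset.sum_const, Finset.sum_const, Finset.filter_filter,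
      ← add_smul, ← add_smul, h1]
    simp
  · intro x hx
    have hxint := Algebra.IsIntegral.isIntegral (R := F) x
    exact mem_monics.2 ⟨minpoly.monic hxint,
      natDegree_minpoly_of_notMem_range Nat.prime_two hfin (Finset.mem_filter.1 hx).2⟩

end QuadraticPolynomials

section LineCount

variable {F : Type*} [Field F] [Fintype F] [DecidableEq F]

lemma sum_ite_sq_eq (hF : ringChar F ≠ 2) (a : F) :
    ∑ y : F, (if y ^ 2 = a then (1 : ℤ) else 0) = 1 + quadraticChar F a := by
  have h := quadraticChar_card_sqrts hF a
  rw [Finset.sum_boole, add_comm, ← h]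
  congr 2
  ext y
  simp

open scoped Classical in
lemma sum_monics_two_dvd {f : F[X]} (hf : f.Monic) (hd : f.natDegree = 3) :
    ∑ A ∈ monics F 2, (if A ∣ f then (1 : ℤ) else 0) = ∑ e, if f.eval e = 0 then 1 else 0 := by
  rw [← Finset.sum_filter, ← Finset.sum_filter]
  symm
  have hfac : ∀ e, f.eval e = 0 → (X - C e) * (f /ₘ (X - C e)) = f := fun e he =>
    mul_divByMonic_eq_iff_isRoot.2 he
  have hmon : ∀ e, f.eval e = 0 → (f /ₘ (X - C e)).Monic := fun e he =>
    (monic_X_sub_C e).of_mul_monic_left (by rw [hfac e he]; exact hf)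
  refine Finset.sum_bij (fun e _ => f /ₘ (X - C e)) ?_ ?_ ?_ ?_
  · intro e he
    have he := (Finset.mem_filter.1 he).2
    refine Finset.mem_filter.2 ⟨mem_monics.2 ⟨hmon e he, ?_⟩, ⟨X - C e, ?_⟩⟩
    · rw [natDegree_divByMonic _ (monic_X_sub_C e), natDegree_X_sub_C, hd]
    · rw [mul_comm, hfac e he]
  · intro e he e' he' h
    have he := (Finset.mem_filter.1 he).2
    have he' := (Finset.mem_filter.1 he').2
    have h1 : (X - C e) * (f /ₘ (X - C e)) = (X - C e') * (f /ₘ (X - C e)) := by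
      rw [hfac e he]
      conv_rhs => rw [h]
      rw [hfac e' he']
    have := mul_right_cancel₀ (hmon e he).ne_zero h1
    simpa using this
  · rintro A hA
    obtain ⟨hA', B, rfl⟩ := Finset.mem_filter.1 hA
    obtain ⟨hAm, hAd⟩ := mem_monics.1 hA'
    have hB : B.Monic := hAm.of_mul_monic_left hf
    rw [hAm.natDegree_mul hB] at hd
    have hB1 : B.natDegree = 1 := by omega
    have hBe : B = X - C (-B.coeff 0) := by rw [C_neg, sub_neg_eq_add]; exact hB.eq_X_add_C hB1
    have hroot : (A * B).eval (-B.coeff 0) = 0 := by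
      rw [eval_mul]
      conv_lhs => rw [hBe]
      simp
    refine ⟨-B.coeff 0, Finset.mem_filter.2 ⟨Finset.mem_univ _, hroot⟩, ?_⟩
    have h1 := hfac _ hroot
    rw [mul_comm A B] at h1 ⊢
    rw [← hBe] at h1 ⊢
    exact mul_left_cancel₀ hB.ne_zero h1
  · intro _ _; rfl

open scoped Classical in
/-- The number of lines `y = m x + n` that meet the curve `y ^ 2 = h x` along the divisor of `A`. -/
noncomputable def lineCount (h A : F[X]) : ℤ :=
  ∑ m : F, ∑ n : F, if A ∣ h - (C m * X + C n) ^ 2 then 1 else 0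

lemma sum_lineCount (hF : ringChar F ≠ 2) {h : F[X]} (hm : h.Monic) (hd : h.natDegree = 3) :
    ∑ A ∈ monics F 2, lineCount h A
      = Fintype.card F * (Fintype.card F + ∑ e, quadraticChar F (h.eval e)) := by
  classical
  have hdeg : ∀ m n : F, ((C m * X + C n) ^ 2).degree < h.degree := by
    intro m n
    rw [degree_eq_natDegree hm.ne_zero, hd]
    have h1 : ((C m * X + C n) ^ 2).degree ≤ 2 • (1 : WithBot ℕ) :=
      (degree_pow_le _ _).trans (nsmul_le_nsmul_right degree_linear_le 2)
    exact h1.trans_lt (by decide)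
  simp only [lineCount]
  rw [Finset.sum_comm]
  calc _ = ∑ m : F, ∑ n : F, ∑ e : F, if (m * e + n) ^ 2 = h.eval e then (1 : ℤ) else 0 := by
        refine Finset.sum_congr rfl fun m _ => ?_
        rw [Finset.sum_comm]
        refine Finset.sum_congr rfl fun n _ => ?_
        rw [sum_monics_two_dvd]
        · refine Finset.sum_congr rfl fun e _ => if_congr ?_ rfl rfl
          simp only [eval_sub, eval_pow, eval_add, eval_mul, eval_C, eval_X, sub_eq_zero]
          exact eq_comm
        · exact hm.sub_of_left (hdeg m n)
        · rw [natDegree_eq_of_degree_eq (degree_sub_eq_left_of_degree_lt (hdeg m n)), hd]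
    _ = ∑ e : F, ∑ m : F, ∑ n : F, if (m * e + n) ^ 2 = h.eval e then (1 : ℤ) else 0 := by
        rw [Finset.sum_congr rfl fun m _ => Finset.sum_comm, Finset.sum_comm]
    _ = ∑ e : F, ∑ m : F, (1 + quadraticChar F (h.eval e)) := by
        refine Finset.sum_congr rfl fun e _ => Finset.sum_congr rfl fun m _ => ?_
        rw [← sum_ite_sq_eq hF]
        exact Fintype.sum_equiv (Equiv.addLeft (m * e)) _ _ fun n => rfl
    _ = _ := by
        simp [Finset.sum_add_distrib, Finset.mul_sum, mul_add]

lemma lineCount_of_ne (hF : ringChar F ≠ 2) (h : F[X]) {r s : F} (hrs : r ≠ s) :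
    lineCount h ((X - C r) * (X - C s))
      = (1 + quadraticChar F (h.eval r)) * (1 + quadraticChar F (h.eval s)) := by
  classical
  have hsub : r - s ≠ 0 := sub_ne_zero.2 hrs
  have hdvd : ∀ f : F[X], (X - C r) * (X - C s) ∣ f ↔ f.eval r = 0 ∧ f.eval s = 0 := by
    intro f
    have hco : IsCoprime (X - C r) (X - C s) := isCoprime_X_sub_C_of_isUnit_sub hsub.isUnit
    constructor
    · intro hd
      exact ⟨dvd_iff_isRoot.1 ((dvd_mul_right _ _).trans hd),
        dvd_iff_isRoot.1 ((dvd_mul_left _ _).trans hd)⟩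
    · rintro ⟨h1, h2⟩
      exact hco.mul_dvd (dvd_iff_isRoot.2 h1) (dvd_iff_isRoot.2 h2)
  rw [lineCount, ← sum_ite_sq_eq hF, ← sum_ite_sq_eq hF, Finset.sum_mul_sum,
    ← Fintype.sum_prod_type', ← Fintype.sum_prod_type']
  let e : F × F ≃ F × F :=
    { toFun := fun x => (x.1 * r + x.2, x.1 * s + x.2)
      invFun := fun y => ((y.1 - y.2) / (r - s), (r * y.2 - s * y.1) / (r - s))
      left_inv := fun x => by ext <;> field_simp <;> ring
      right_inv := fun y => by ext <;> field_simp <;> ring }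
  refine Fintype.sum_equiv e _ _ fun x => ?_
  rw [ite_zero_mul_ite_zero, mul_one]
  refine if_congr ?_ rfl rfl
  rw [hdvd]
  simp only [eval_sub, eval_pow, eval_add, eval_mul, eval_C, eval_X, sub_eq_zero]
  exact and_congr eq_comm eq_comm

lemma lineCount_self (hF : ringChar F ≠ 2) {h : F[X]} {r : F}
    (hns : h.eval r = 0 → h.derivative.eval r ≠ 0) :
    lineCount h ((X - C r) * (X - C r))
      = quadraticChar F (h.eval r) ^ 2 + quadraticChar F (h.eval r) := by
  classical
  have h2 : (2 : F) ≠ 0 := Ring.two_ne_zero hF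
  have hdvd : ∀ f : F[X], (X - C r) * (X - C r) ∣ f ↔ f.eval r = 0 ∧ f.derivative.eval r = 0 := by
    intro f
    constructor
    · rintro ⟨g, rfl⟩
      simp
    · rintro ⟨h1, h2⟩
      obtain ⟨g, rfl⟩ := dvd_iff_isRoot.2 h1
      refine mul_dvd_mul_left _ (dvd_iff_isRoot.2 ?_)
      simpa using h2
  have hcond : ∀ m n : F, (X - C r) * (X - C r) ∣ h - (C m * X + C n) ^ 2 ↔
      (m * r + n) ^ 2 = h.eval r ∧ 2 * (m * r + n) * m = h.derivative.eval r := by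
    intro m n
    rw [hdvd]
    simp only [eval_sub, eval_pow, eval_add, eval_mul, eval_C, eval_X, sub_eq_zero,
      derivative_sub, derivative_pow, derivative_add, derivative_mul, derivative_C, derivative_X]
    refine and_congr eq_comm (eq_comm.trans ?_)
    simp
  simp only [lineCount, hcond]
  by_cases hr : h.eval r = 0
  · rw [hr, MulChar.map_zero]
    refine Finset.sum_eq_zero fun m _ => Finset.sum_eq_zero fun n _ => if_neg ?_
    rintro ⟨h3, h4⟩
    rw [pow_eq_zero_iff two_ne_zero] at h3
    rw [h3] at h4
    exact hns hr (by rw [← h4]; ring)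
  · rw [quadraticChar_sq_one hr, ← sum_ite_sq_eq hF]
    have : ∀ y : F, (if y ^ 2 = h.eval r then (1 : ℤ) else 0) = ∑ m : F,
        if y ^ 2 = h.eval r ∧ 2 * y * m = h.derivative.eval r then (1 : ℤ) else 0 := by
      intro y
      by_cases hy : y ^ 2 = h.eval r
      · have hy0 : y ≠ 0 := by rintro rfl; exact hr (by rw [← hy]; ring)
        rw [if_pos hy, Finset.sum_eq_single (h.derivative.eval r / (2 * y))]
        · rw [if_pos ⟨hy, by field_simp⟩]
        · intro m _ hm
          refine if_neg fun hh => hm ?_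
          rw [← hh.2]
          field_simp
        · simp
      · simp [hy]
    simp only [this]
    rw [Finset.sum_comm (f := fun y m : F => if y ^ 2 = _ ∧ _ then (1 : ℤ) else 0)]
    refine Finset.sum_congr rfl fun m _ => ?_
    exact Fintype.sum_equiv (Equiv.addLeft (m * r)) _ _ fun n => rfl

variable {K : Type*} [Field K] [Fintype K] [DecidableEq K] [Algebra F K]

lemma lineCount_minpoly (hF : ringChar F ≠ 2) (hfin : Module.finrank F K = 2) (h : F[X]) {x : K}
    (hx : x ∉ (algebraMap F K).range) :
    lineCount h (minpoly F x) = 1 + quadraticChar K (aeval x h) := by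
  classical
  have hK : ringChar K ≠ 2 := by rwa [ringChar_eq_of_algebra (F := F)]
  have hinj : Function.Injective
      fun y : F × F => algebraMap F K y.1 * x + algebraMap F K y.2 := by
    rintro ⟨m, n⟩ ⟨m', n'⟩ hmn
    simp only at hmn
    have h1 : algebraMap F K (m - m') * x = algebraMap F K (n' - n) := by
      rw [map_sub, map_sub]; linear_combination hmn
    by_cases hm : m - m' = 0
    · rw [hm, map_zero, zero_mul, eq_comm, map_eq_zero_iff _ (algebraMap F K).injective] at h1
      rw [sub_eq_zero.1 hm, sub_eq_zero.1 h1]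
    · refine absurd ⟨(n' - n) / (m - m'), ?_⟩ hx
      rw [map_div₀, ← h1]
      have : algebraMap F K (m - m') ≠ 0 := (_root_.map_ne_zero _).2 hm
      field_simp
  have hbij : Function.Bijective
      fun y : F × F => algebraMap F K y.1 * x + algebraMap F K y.2 := by
    rw [Fintype.bijective_iff_injective_and_card]
    refine ⟨hinj, ?_⟩
    rw [Module.card_eq_pow_finrank (K := F) (V := K), hfin, Fintype.card_prod, sq]
  rw [lineCount, ← sum_ite_sq_eq hK, ← Fintype.sum_prod_type']
  refine Fintype.sum_bijective _ hbij _ _ fun y => if_congr ?_ rfl rfl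
  rw [← minpoly.isIntegrallyClosed_dvd_iff (Algebra.IsIntegral.isIntegral x)]
  simp only [map_sub, map_pow, map_add, map_mul, aeval_C, aeval_X, sub_eq_zero]
  exact eq_comm

/-- The number of points of `y ^ 2 = h x` over a quadratic extension. -/
theorem sum_quadraticChar_quadratic_extension (hF : ringChar F ≠ 2)
    (hfin : Module.finrank F K = 2) {h : F[X]} (hm : h.Monic) (hd : h.natDegree = 3)
    (hns : ∀ r, h.eval r = 0 → h.derivative.eval r ≠ 0) :
    ∑ x : K, quadraticChar K (aeval x h)
      = 2 * Fintype.card F - (∑ r : F, quadraticChar F (h.eval r)) ^ 2 := by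
  classical
  have key := two_mul_sum_monics_two (K := K) hfin (lineCount h)
  rw [sum_lineCount hF hm hd] at key
  rw [Finset.sum_congr rfl fun x hx => lineCount_minpoly hF hfin h (Finset.mem_filter.1 hx).2,
    Finset.sum_congr (s₁ := (Finset.univ : Finset F)) (f := fun r => lineCount h _) rfl
      fun r _ => lineCount_self hF (hns r)] at key
  have hpairs : ∑ r : F, ∑ s : F, lineCount h ((X - C r) * (X - C s))
      = (Fintype.card F + ∑ r, quadraticChar F (h.eval r)) ^ 2
        + ∑ r, (quadraticChar F (h.eval r) ^ 2 + quadraticChar F (h.eval r)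
          - (1 + quadraticChar F (h.eval r)) ^ 2) := by
    have h1 : ∀ r s : F, lineCount h ((X - C r) * (X - C s))
        = (1 + quadraticChar F (h.eval r)) * (1 + quadraticChar F (h.eval s))
          + if r = s then (quadraticChar F (h.eval r) ^ 2 + quadraticChar F (h.eval r)
          - (1 + quadraticChar F (h.eval r)) ^ 2) else 0 := by
      intro r s
      split_ifs with hrs
      · subst hrs
        rw [lineCount_self hF (hns r)]
        ring
      · rw [lineCount_of_ne hF h hrs, add_zero]
    simp only [h1, Finset.sum_add_distrib, ← Finset.sum_mul_sum, Finset.sum_ite_eq,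
      Finset.mem_univ, if_true]
    simp [sq]
  rw [hpairs] at key
  have hsplit := Finset.sum_filter_add_sum_filter_not Finset.univ
    (fun x : K => x ∈ (algebraMap F K).range) fun x => quadraticChar K (aeval x h)
  have hbase : ∑ x ∈ Finset.univ.filter (fun x : K => x ∈ (algebraMap F K).range),
      quadraticChar K (aeval x h) = ∑ r : F, quadraticChar F (h.eval r) ^ 2 := by
    symm
    refine Finset.sum_bij (fun r _ => algebraMap F K r) ?_ ?_ ?_ ?_
    · intro r _; simp
    · intro r _ s _ h; exact (algebraMap F K).injective h
    · intro x hx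
      obtain ⟨r, rfl⟩ := (Finset.mem_filter.1 hx).2
      exact ⟨r, Finset.mem_univ _, rfl⟩
    · intro r _
      rw [aeval_algebraMap_apply, ← quadraticChar_norm (K := K) hF, Algebra.norm_algebraMap, hfin, map_pow]
      rfl
  have hcard : ((Finset.univ.filter fun x : K => x ∉ (algebraMap F K).range).card : ℤ)
      = Fintype.card F ^ 2 - Fintype.card F := by
    have h1 := Finset.card_filter_add_card_filter_not (s := (Finset.univ : Finset K))
      fun x : K => x ∈ (algebraMap F K).range
    have h2 : (Finset.univ.filter fun x : K => x ∈ (algebraMap F K).range)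
        = Finset.univ.image (algebraMap F K) := by
      ext x; simp
    rw [h2, Finset.card_image_of_injective _ (algebraMap F K).injective, Finset.card_univ,
      Finset.card_univ, Module.card_eq_pow_finrank (K := F) (V := K), hfin] at h1
    rw [eq_sub_iff_add_eq']
    exact_mod_cast h1
  simp only [Finset.sum_add_distrib, Finset.sum_sub_distrib, Finset.sum_const, nsmul_eq_mul,
    mul_one, hcard, add_sq, one_pow, ← Finset.mul_sum, Finset.card_univ] at key
  rw [← hsplit, hbase]
  linarith
end LineCount

section CubicLSeries

variable {F : Type*} [Field F] [Fintype F] [DecidableEq F]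

/-- The quadratic residue symbol of a cubic `h` modulo `A`. -/
noncomputable def resChar (h A : F[X]) : ℤ :=
  quadraticChar F (A.resultant h A.natDegree 3)

variable {h : F[X]}

lemma resChar_one : resChar h 1 = 1 := by
  simp [resChar]

lemma resChar_mul (hd : h.natDegree = 3) (A B : F[X]) (hA : A.Monic) (hB : B.Monic) :
    resChar h (A * B) = resChar h A * resChar h B := by
  rw [resChar, hA.natDegree_mul hB, resultant_mul_left _ _ _ _ hd.le, map_mul, resChar, resChar]

lemma resChar_X_sub_C (hd : h.natDegree = 3) (r : F) :
    resChar h (X - C r) = quadraticChar F (h.eval r) := by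
  rw [resChar, natDegree_X_sub_C, resultant_X_sub_C_left _ _ _ hd.le]

lemma lCoeff_resChar_eq_zero (hF : ringChar F ≠ 2) (hm : h.Monic) (hd : h.natDegree = 3) {n : ℕ}
    (hn : 3 ≤ n) : lCoeff (resChar h) n = 0 := by
  obtain ⟨d, hd1⟩ := quadraticChar_exists_neg_one hF
  have hd0 : d ≠ 0 := by rintro rfl; simp at hd1
  let T : F → F[X] → F[X] := fun d A => A + C (d - 1) * (A %ₘ h)
  have hmodmod : ∀ A : F[X], (A %ₘ h) %ₘ h = A %ₘ h := fun A =>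
    (modByMonic_eq_self_iff hm).2 (degree_modByMonic_lt A hm)
  have hTmod : ∀ d A, T d A %ₘ h = C d * (A %ₘ h) := by
    intro d A
    simp only [T]
    rw [add_modByMonic, ← smul_eq_C_mul, smul_modByMonic, hmodmod, smul_eq_C_mul, C_sub, C_1]
    ring
  have hTT : ∀ d e A, d * e = 1 → T e (T d A) = A := by
    intro d e A hde
    change T d A + C (e - 1) * (T d A %ₘ h) = A
    rw [hTmod, ← mul_assoc, ← C_mul, sub_mul, mul_comm e, hde, one_mul]
    simp only [T, C_sub, C_1]
    ring
  have hTmem : ∀ d, ∀ A ∈ monics F n, T d A ∈ monics F n := by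
    intro d A hA
    obtain ⟨hAm, hAd⟩ := mem_monics.1 hA
    have hlt : (C (d - 1) * (A %ₘ h)).degree < A.degree := by
      rw [← smul_eq_C_mul]
      refine (degree_smul_le _ _).trans_lt ((degree_modByMonic_lt A hm).trans_le ?_)
      rw [degree_eq_natDegree hm.ne_zero, degree_eq_natDegree hAm.ne_zero, hd, hAd]
      exact_mod_cast hn
    exact mem_monics.2 ⟨hAm.add_of_left hlt,
      (natDegree_eq_of_degree_eq (degree_add_eq_left_of_degree_lt hlt)).trans hAd⟩
  have hres : ∀ A ∈ monics F n,
      A.resultant h A.natDegree 3 = (A %ₘ h).resultant h n 3 := by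
    intro A hA
    obtain ⟨hAm, hAd⟩ := mem_monics.1 hA
    conv_lhs => rw [hAd, ← modByMonic_add_div A h]
    refine resultant_add_mul_left _ _ _ _ _ ?_ hd.le
    rw [natDegree_divByMonic _ hm, hAd, hd]
    omega
  have hneg : ∀ A ∈ monics F n, resChar h (T d A) = - resChar h A := by
    intro A hA
    rw [resChar, resChar, hres _ hA, hres _ (hTmem d A hA), hTmod, resultant_C_mul_left, map_mul,
      map_pow, hd1]
    ring
  have hsum : lCoeff (resChar h) n = - lCoeff (resChar h) n := by
    conv_lhs => rw [lCoeff]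
    rw [lCoeff, ← Finset.sum_neg_distrib]
    symm
    refine Finset.sum_bij' (fun A _ => T d A) (fun A _ => T d⁻¹ A) (hTmem d) (hTmem d⁻¹) ?_ ?_ ?_
    · intro A _; exact hTT _ _ _ (mul_inv_cancel₀ hd0)
    · intro A _; exact hTT _ _ _ (inv_mul_cancel₀ hd0)
    · intro A hA; exact (hneg A hA).symm
  linarith

variable {K : Type*} [Field K] [Fintype K] [DecidableEq K] [Algebra F K]

lemma mangoldtSum_resChar (hF : ringChar F ≠ 2) (hd : h.natDegree = 3) {k : ℕ} (hk : k.Prime)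
    (hfin : Module.finrank F K = k) :
    mangoldtSum (resChar h) k = ∑ x : K, quadraticChar K (aeval x h) := by
  refine mangoldtSum_eq_sum hk hfin _ _ ?_ ?_
  · intro r
    rw [aeval_algebraMap_apply, ← quadraticChar_norm (K := K) hF, Algebra.norm_algebraMap, hfin,
      map_pow, resChar_X_sub_C hd]
    rfl
  · intro x hx
    rw [resChar, resultant_minpoly hk hfin hx h hd.le, quadraticChar_norm hF]

lemma mangoldtSum_one {F R : Type*} [Field F] [Fintype F] [CommRing R] (χ : F[X] → R) : mangoldtSum χ 1 = ∑ r : F, χ (X - C r) := by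
  simp [mangoldtSum, monicIrreducibles_one, sum_monics_one]

/-- The traces of the powers of Frobenius on the curve `y ^ 2 = h x`, in terms of the first one. -/
theorem mangoldtSum_resChar_recurrence (hF : ringChar F ≠ 2) (hfin : Module.finrank F K = 2)
    (hm : h.Monic) (hd : h.natDegree = 3)
    (hns : ∀ r, h.eval r = 0 → h.derivative.eval r ≠ 0) :
    let s := ∑ r : F, quadraticChar F (h.eval r)
    let q : ℤ := Fintype.card F
    mangoldtSum (resChar h) 3 = s ^ 3 - 3 * q * s ∧
    mangoldtSum (resChar h) 5 = s ^ 5 - 5 * q * s ^ 3 + 5 * q ^ 2 * s ∧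
    mangoldtSum (resChar h) 7 = s ^ 7 - 7 * q * s ^ 5 + 14 * q ^ 2 * s ^ 3 - 7 * q ^ 3 * s := by
  intro s q
  have h0 : lCoeff (resChar h) 0 = 1 := by rw [lCoeff, sum_monics_zero, resChar_one]
  have hM1 : mangoldtSum (resChar h) 1 = s := by
    rw [mangoldtSum_one]
    exact Finset.sum_congr rfl fun r _ => resChar_X_sub_C hd r
  have hM2 : mangoldtSum (resChar h) 2 = 2 * q - s ^ 2 := by
    rw [mangoldtSum_resChar (K := K) hF hd Nat.prime_two hfin]
    exact sum_quadraticChar_quadratic_extension hF hfin hm hd hns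
  have hN := natCast_mul_lCoeff (resChar_one (h := h)) (resChar_mul hd)
  have h1 : lCoeff (resChar h) 1 = s := by
    have := hN 1
    simpa [h0, hM1] using this
  have h2 : lCoeff (resChar h) 2 = q := by
    have := hN 2
    simp [Finset.sum_Icc_succ_top, h0, h1, hM1, hM2] at this
    linarith
  have hz : ∀ n, lCoeff (resChar h) (n + 3) = 0 := fun n =>
    lCoeff_resChar_eq_zero hF hm hd (Nat.le_add_left 3 n)
  have hrec : ∀ n, mangoldtSum (resChar h) (n + 3)
      = - (mangoldtSum (resChar h) (n + 2) * s + mangoldtSum (resChar h) (n + 1) * q) := by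
    intro n
    have := hN (n + 3)
    rw [hz, mul_zero, Finset.sum_Icc_succ_top (by omega), Finset.sum_Icc_succ_top (by omega),
      Finset.sum_Icc_succ_top (by omega), Finset.sum_eq_zero] at this
    · rw [show n + 2 + 1 - (n + 2 + 1) = 0 by omega, show n + 2 + 1 - (n + 1 + 1) = 1 by omega,
        show n + 2 + 1 - (n + 1) = 2 by omega, h0, h1, h2] at this
      linarith
    · intro k hk
      have := (Finset.mem_Icc.1 hk).2
      rw [show n + 2 + 1 - k = (n - k) + 3 by omega, hz, mul_zero]
  have e3 := hrec 0
  have e4 := hrec 1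
  have e5 := hrec 2
  have e6 := hrec 3
  have e7 := hrec 4
  norm_num only [] at e3 e4 e5 e6 e7
  rw [hM2, hM1] at e3
  rw [e3, hM2] at e4
  rw [e4, e3] at e5
  rw [e5, e4] at e6
  rw [e6, e5] at e7
  refine ⟨?_, ?_, ?_⟩
  · rw [e3]; ring
  · rw [e5]; ring
  · rw [e7]; ring

end CubicLSeries

lemma sum_fin_succ_cons {F R : Type*} [Fintype F] [AddCommMonoid R] {n : ℕ}
    (f : (Fin (n + 1) → F) → R) :
    ∑ c, f c = ∑ a : F, ∑ c : Fin n → F, f (Fin.cons a c) := by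
  rw [← Fintype.sum_prod_type']
  exact (Fintype.sum_equiv (Fin.consEquiv fun _ => F) _ _ fun _ => rfl).symm

lemma sum_fin_succ_snoc {F R : Type*} [Fintype F] [AddCommMonoid R] {n : ℕ}
    (f : (Fin (n + 1) → F) → R) :
    ∑ c, f c = ∑ a : F, ∑ c : Fin n → F, f (Fin.snoc c a) := by
  rw [← Fintype.sum_prod_type']
  exact (Fintype.sum_equiv (Fin.snocEquiv fun _ => F) _ _ fun _ => rfl).symm

section HasseDavenport

variable {F : Type*} [Field F] [Fintype F] [DecidableEq F]

/-- The complex valued quadratic character. -/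
noncomputable def quadC (F : Type*) [Field F] [Fintype F] [DecidableEq F] : MulChar F ℂ :=
  (quadraticChar F).ringHomComp (Int.castRingHom ℂ)

lemma quadC_apply (x : F) : quadC F x = (quadraticChar F x : ℂ) := rfl

lemma quadC_ne_one (hF : ringChar F ≠ 2) : quadC F ≠ 1 := by
  obtain ⟨a, ha⟩ := quadraticChar_exists_neg_one hF
  intro h
  have h1 := congrArg (fun χ : MulChar F ℂ => χ a) h
  have ha0 : a ≠ 0 := by rintro rfl; simp at ha
  simp only [quadC_apply, ha, MulChar.one_apply ha0.isUnit] at h1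
  norm_num at h1

lemma sum_quadC (hF : ringChar F ≠ 2) : ∑ x : F, quadC F x = 0 :=
  MulChar.sum_eq_zero_of_ne_one (quadC_ne_one hF)

/-- The multiplicative function on monic polynomials attached to a Gauss sum. -/
noncomputable def gaussChar (ψ : AddChar F ℂ) (A : F[X]) : ℂ :=
  quadC F (A.coeff 0) * ψ A.nextCoeff

variable {ψ : AddChar F ℂ}

lemma gaussChar_one : gaussChar ψ 1 = 1 := by
  simp [gaussChar, nextCoeff]

lemma gaussChar_mul (A B : F[X]) (hA : A.Monic) (hB : B.Monic) :
    gaussChar ψ (A * B) = gaussChar ψ A * gaussChar ψ B := by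
  rw [gaussChar, mul_coeff_zero, hA.nextCoeff_mul hB, map_mul, AddChar.map_add_eq_mul, gaussChar,
    gaussChar]
  ring

lemma gaussChar_X_sub_C (r : F) : gaussChar ψ (X - C r) = quadC F (-r) * ψ (-r) := by
  rw [gaussChar, nextCoeff_X_sub_C]
  simp

lemma lCoeff_gaussChar_one : lCoeff (gaussChar ψ) 1 = gaussSum (quadC F) ψ := by
  rw [lCoeff, sum_monics_one, gaussSum]
  exact Fintype.sum_equiv (Equiv.neg F) _ _ fun r => gaussChar_X_sub_C r

lemma lCoeff_gaussChar_eq_zero (hF : ringChar F ≠ 2) (n : ℕ) :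
    lCoeff (gaussChar ψ) (n + 2) = 0 := by
  rw [lCoeff, sum_monics, sum_fin_succ_cons, Finset.sum_comm]
  refine Finset.sum_eq_zero fun c _ => ?_
  have : ∀ a : F, gaussChar ψ (monicOfCoeffs (n + 2) (Fin.cons a c))
      = quadC F a * ψ (c (Fin.last n)) := by
    intro a
    have h0 := coeff_monicOfCoeffs (n + 2) (Fin.cons a c : Fin (n + 2) → F) 0
    have h1 := coeff_monicOfCoeffs (n + 2) (Fin.cons a c : Fin (n + 2) → F) (Fin.last n).succ
    rw [Fin.cons_succ] at h1
    rw [gaussChar, nextCoeff_of_natDegree_pos (by rw [natDegree_monicOfCoeffs]; omega),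
      natDegree_monicOfCoeffs]
    congr 2
  rw [Finset.sum_congr rfl fun a _ => this a, ← Finset.sum_mul, sum_quadC hF, zero_mul]

lemma mangoldtSum_gaussChar (hF : ringChar F ≠ 2) (n : ℕ) :
    mangoldtSum (gaussChar ψ) (n + 1) = (-1) ^ n * gaussSum (quadC F) ψ ^ (n + 1) := by
  have h0 : lCoeff (gaussChar ψ) 0 = 1 := by rw [lCoeff, sum_monics_zero, gaussChar_one]
  have hN := natCast_mul_lCoeff (gaussChar_one (ψ := ψ)) gaussChar_mul
  induction n with
  | zero =>
    have := hN 1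
    simp only [Nat.cast_one, one_mul, Finset.Icc_self, Finset.sum_singleton, Nat.sub_self, h0,
      mul_one, lCoeff_gaussChar_one] at this
    simp [← this]
  | succ n ih =>
    have := hN (n + 2)
    rw [lCoeff_gaussChar_eq_zero hF, mul_zero, Finset.sum_Icc_succ_top (by omega),
      Finset.sum_Icc_succ_top (by omega), Finset.sum_eq_zero] at this
    · rw [show n + 1 + 1 - (n + 1 + 1) = 0 by omega, show n + 1 + 1 - (n + 1) = 1 by omega, h0,
        lCoeff_gaussChar_one, ih] at this
      linear_combination -this
    · intro k hk
      have := (Finset.mem_Icc.1 hk).2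
      rw [show n + 1 + 1 - k = (n - k) + 2 by omega, lCoeff_gaussChar_eq_zero hF, mul_zero]

variable {K : Type*} [Field K] [Fintype K] [DecidableEq K] [Algebra F K]

/-- The lift of an additive character along the trace. -/
noncomputable def traceChar (ψ : AddChar F ℂ) (K : Type*) [Field K] [Algebra F K] : AddChar K ℂ :=
  ψ.compAddMonoidHom (Algebra.trace F K).toAddMonoidHom

lemma traceChar_apply {F K : Type*} [Field F] [Field K] [Algebra F K] (ψ : AddChar F ℂ) (x : K) :
    traceChar ψ K x = ψ (Algebra.trace F K x) := rfl

lemma traceChar_isPrimitive {F K : Type*} [Field F] [Fintype F] [Field K] [Fintype K] [Algebra F K]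
    {ψ : AddChar F ℂ} (hψ : ψ.IsPrimitive) : (traceChar ψ K).IsPrimitive := by
  refine AddChar.IsPrimitive.of_ne_one fun h => ?_
  have h1 := hψ one_ne_zero
  apply h1
  ext y
  obtain ⟨x, rfl⟩ := Algebra.trace_surjective F K y
  rw [AddChar.mulShift_apply, one_mul, ← traceChar_apply, h]
  simp

/-- The Hasse–Davenport relation for extensions of odd prime degree. -/
theorem gaussSum_traceChar (hF : ringChar F ≠ 2) {k : ℕ} (hk : k.Prime) (hodd : Odd k)
    (hfin : Module.finrank F K = k) :
    gaussSum (quadC K) (traceChar ψ K) = gaussSum (quadC F) ψ ^ k := by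
  obtain ⟨m, rfl⟩ := hodd
  have h1 := mangoldtSum_gaussChar (ψ := ψ) hF (2 * m)
  rw [pow_mul, neg_one_sq, one_pow, one_mul] at h1
  rw [← h1, mangoldtSum_eq_sum hk hfin (gaussChar ψ) fun x => quadC K (-x) * traceChar ψ K (-x)]
  · exact (Fintype.sum_equiv (Equiv.neg K) _ _ fun r => rfl).symm
  · intro r
    rw [gaussChar_X_sub_C, ← map_neg, traceChar_apply, Algebra.trace_algebraMap, hfin,
      AddChar.map_nsmul_eq_pow, mul_pow, quadC_apply, quadC_apply,
      ← quadraticChar_norm (K := K) hF, Algebra.norm_algebraMap, hfin, map_pow]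
    push_cast
    rfl
  · intro x hx
    have hxint := Algebra.IsIntegral.isIntegral (R := F) x
    have hprod := minpoly_map_eq_prod hk hfin hx
    rw [gaussChar, quadC_apply, quadC_apply, ← quadraticChar_norm (K := K) hF, traceChar_apply]
    congr 3
    · apply (algebraMap F K).injective
      rw [FiniteField.algebraMap_norm_eq_prod_pow, hfin, ← coeff_map, hprod, coeff_zero_prod]
      refine Finset.prod_congr rfl fun i _ => ?_
      rw [Odd.neg_pow]
      · rw [coeff_sub, coeff_X_zero, coeff_C_zero, zero_sub, Fintype.card_eq_nat_card]
      · rw [← Fintype.card_eq_nat_card]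
        exact (Nat.odd_iff.2 (FiniteField.odd_card_of_char_ne_two hF)).pow
    · apply (algebraMap F K).injective
      rw [map_neg, map_neg, FiniteField.algebraMap_trace_eq_sum_pow, hfin,
        ← nextCoeff_map (algebraMap F K).injective, hprod, prod_X_sub_C_nextCoeff]
      simp

lemma gaussSum_quadC_sq (hF : ringChar F ≠ 2) (hψ : ψ.IsPrimitive) :
    gaussSum (quadC F) ψ ^ 2 = quadC F (-1) * Fintype.card F :=
  gaussSum_sq (quadC_ne_one hF) ((quadraticChar_isQuadratic F).comp _) hψ

end HasseDavenport

section DualBasis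

variable {F K : Type*} [Field F] [Field K] [Algebra F K] {k : ℕ} {x : K}

lemma aeval_derivative_minpoly_ne_zero [Finite F] [Finite K] (x : K) :
    aeval x (derivative (minpoly F x)) ≠ 0 :=
  (Algebra.IsSeparable.isSeparable F x).aeval_derivative_ne_zero (minpoly.aeval F x)

/-- Euler's formula for the traces of the quotients of powers by the different. -/
lemma trace_pow_div_derivative [Fintype F] [Fintype K] (hk : k.Prime)
    (hfin : Module.finrank F K = k) (hx : x ∉ (algebraMap F K).range) {i : ℕ} (hi : i < k) :
    Algebra.trace F K ((aeval x (derivative (minpoly F x)))⁻¹ * x ^ i)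
      = if i + 1 = k then 1 else 0 := by
  have hdeg := natDegree_minpoly_of_notMem_range hk hfin hx
  have hxint : IsIntegral F x := Algebra.IsIntegral.isIntegral x
  let pb : PowerBasis F K :=
    { gen := x
      dim := (minpoly F x).natDegree
      basis := haveI : Nonempty (Fin (minpoly F x).natDegree) := ⟨⟨0, by rw [hdeg]; exact hk.pos⟩⟩
        basisOfLinearIndependentOfCardEqFinrank (linearIndependent_pow x)
        (by rw [Fintype.card_fin, hdeg, hfin])
      basis_eq_pow := fun i => by simp }
  let j : Fin pb.dim := ⟨k - 1, by change _ < (minpoly F x).natDegree; rw [hdeg]; have := hk.pos; omega⟩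
  let i' : Fin pb.dim := ⟨i, by change _ < (minpoly F x).natDegree; rw [hdeg]; exact hi⟩
  have h1 := (Module.Basis.traceDual_eq_iff (b := pb.basis)).1 rfl j i'
  rw [Module.Basis.traceDual_powerBasis_eq, Algebra.traceForm_apply, pb.basis_eq_pow] at h1
  have hc : (minpolyDiv F x).coeff (k - 1) = 1 := by
    have := (minpolyDiv_monic hxint).coeff_natDegree
    rwa [show (minpolyDiv F x).natDegree = k - 1 by
      have := natDegree_minpolyDiv_succ hxint
      omega] at this
  have e1 : (i' = j) ↔ i + 1 = k := by
    rw [Fin.ext_iff]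
    change i = k - 1 ↔ _
    have := hk.pos
    omega
  simp only [e1] at h1
  rw [← h1]
  congr 2
  change _ = (minpolyDiv F x).coeff (k - 1) / aeval x (derivative (minpoly F x))
  rw [hc, one_div]

lemma sum_eq_sum_pow_basis [Fintype F] [Fintype K] {R : Type*} [AddCommMonoid R] (hk : k.Prime)
    (hfin : Module.finrank F K = k) (hx : x ∉ (algebraMap F K).range) (f : K → R) :
    ∑ z, f z = ∑ c : Fin k → F, f (∑ i, algebraMap F K (c i) * x ^ (i : ℕ)) := by
  have hdeg := natDegree_minpoly_of_notMem_range hk hfin hx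
  have hli := linearIndependent_pow (K := F) x
  rw [hdeg] at hli
  have : Nonempty (Fin k) := ⟨⟨0, hk.pos⟩⟩
  let b := basisOfLinearIndependentOfCardEqFinrank hli (by rw [Fintype.card_fin, hfin])
  refine Fintype.sum_equiv b.equivFun.toEquiv _ _ fun z => ?_
  congr 1
  conv_lhs => rw [← b.sum_equivFun z]
  simp [b, Algebra.smul_def]

end DualBasis

section Different

variable {F K : Type*} [Field F] [Fintype F] [Field K] [Fintype K] [DecidableEq K] [Algebra F K]

lemma quadraticChar_pow_card_pow {F K : Type*} [Field F] [Fintype F] [Field K] [Fintype K]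
    [DecidableEq K] (hF : ringChar F ≠ 2) (y : K) (i : ℕ) :
    quadraticChar K (y ^ Fintype.card F ^ i) = quadraticChar K y := by
  obtain ⟨m, hm⟩ : Odd (Fintype.card F ^ i) :=
    (Nat.odd_iff.2 (FiniteField.odd_card_of_char_ne_two hF)).pow
  rw [hm, map_pow]
  rcases eq_or_ne y 0 with rfl | hy
  · simp
  · rw [pow_succ, pow_mul, quadraticChar_sq_one hy, one_pow, one_mul]

lemma quadraticChar_sub_pow_card (hF : ringChar F ≠ 2) (x : K) {i j : ℕ}
    (hij : i + j = Module.finrank F K) :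
    quadraticChar K (x - x ^ Fintype.card F ^ j)
      = quadraticChar K (-1) * quadraticChar K (x - x ^ Fintype.card F ^ i) := by
  have h := aeval_pow_card_pow (X - X ^ Fintype.card F ^ j : F[X]) x i
  simp only [map_sub, map_pow, aeval_X] at h
  rw [← pow_mul, ← pow_add, hij, ← Module.card_eq_pow_finrank, FiniteField.pow_card] at h
  rw [← quadraticChar_pow_card_pow hF _ i, ← h, ← map_mul]
  congr 1
  ring

lemma aeval_derivative_minpoly {F K : Type*} [Field F] [Fintype F] [Field K] [Fintype K]
    [Algebra F K] {k : ℕ} (hk : k.Prime) (hfin : Module.finrank F K = k)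
    {x : K} (hx : x ∉ (algebraMap F K).range) :
    aeval x (derivative (minpoly F x))
      = ∏ i ∈ Finset.range (k - 1), (x - x ^ Fintype.card F ^ (i + 1)) := by
  rw [← eval_map_algebraMap, ← derivative_map, minpoly_map_eq_prod hk hfin hx]
  obtain ⟨m, rfl⟩ : ∃ m, k = m + 1 := ⟨k - 1, by have := hk.pos; omega⟩
  rw [Finset.prod_range_succ', derivative_mul]
  simp [eval_prod]

lemma quadraticChar_derivative_minpoly_five (hF : ringChar F ≠ 2)
    (hfin : Module.finrank F K = 5) {x : K} (hx : x ∉ (algebraMap F K).range) :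
    quadraticChar K (aeval x (derivative (minpoly F x))) = 1 := by
  have hne := aeval_derivative_minpoly_ne_zero (F := F) x
  rw [aeval_derivative_minpoly Nat.prime_five hfin hx] at hne ⊢
  simp only [Nat.add_one_sub_one, Finset.prod_range_succ, Finset.prod_range_zero, one_mul,
    Nat.reduceAdd, zero_add, mul_ne_zero_iff, map_mul] at hne ⊢
  rw [quadraticChar_sub_pow_card hF x (i := 1) (j := 4) (by rw [hfin]),
    quadraticChar_sub_pow_card hF x (i := 2) (j := 3) (by rw [hfin])]
  have h1 := quadraticChar_sq_one hne.1.1.1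
  have h2 := quadraticChar_sq_one hne.1.1.2
  have h3 := quadraticChar_sq_one (F := K) (neg_ne_zero.2 one_ne_zero)
  rw [sq] at h1 h2 h3
  linear_combination h1 * quadraticChar K (x - x ^ Fintype.card F ^ 2) ^ 2 *
    quadraticChar K (-1) ^ 2 + h2 * quadraticChar K (-1) ^ 2 + h3

lemma quadraticChar_derivative_minpoly_seven (hF : ringChar F ≠ 2)
    (hfin : Module.finrank F K = 7) {x : K} (hx : x ∉ (algebraMap F K).range) :
    quadraticChar K (aeval x (derivative (minpoly F x))) = quadraticChar K (-1) := by
  have hne := aeval_derivative_minpoly_ne_zero (F := F) x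
  rw [aeval_derivative_minpoly Nat.prime_seven hfin hx] at hne ⊢
  simp only [Nat.add_one_sub_one, Finset.prod_range_succ, Finset.prod_range_zero, one_mul,
    Nat.reduceAdd, zero_add, mul_ne_zero_iff, map_mul] at hne ⊢
  rw [quadraticChar_sub_pow_card hF x (i := 1) (j := 6) (by rw [hfin]),
    quadraticChar_sub_pow_card hF x (i := 2) (j := 5) (by rw [hfin]),
    quadraticChar_sub_pow_card hF x (i := 3) (j := 4) (by rw [hfin])]
  have h1 := quadraticChar_sq_one hne.1.1.1.1.1
  have h2 := quadraticChar_sq_one hne.1.1.1.1.2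
  have h3 := quadraticChar_sq_one hne.1.1.1.2
  have h4 := quadraticChar_sq_one (F := K) (neg_ne_zero.2 one_ne_zero)
  linear_combination h1 * quadraticChar K (x - x ^ Fintype.card F ^ 2) ^ 2 *
    quadraticChar K (x - x ^ Fintype.card F ^ 3) ^ 2 * quadraticChar K (-1) ^ 3
    + h2 * quadraticChar K (x - x ^ Fintype.card F ^ 3) ^ 2 * quadraticChar K (-1) ^ 3
    + h3 * quadraticChar K (-1) ^ 3 + h4 * quadraticChar K (-1)

end Different

section CharacterSums

variable {F : Type*} [Field F] [Fintype F] [DecidableEq F] {ψ : AddChar F ℂ}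

lemma card_mul_ite_eq (hψ : ψ.IsPrimitive) (a b : F) :
    (Fintype.card F : ℂ) * (if a = b then 1 else 0) = ∑ v, ψ (v * a) * ψ (-(v * b)) := by
  have h := AddChar.sum_mulShift (a - b) hψ
  simp only [sub_eq_zero, mul_sub, sub_eq_add_neg (_ * _), AddChar.map_add_eq_mul] at h
  rw [h]
  split_ifs <;> simp

lemma sum_quadC_mul_mulShift (hF : ringChar F ≠ 2) (a : F) :
    ∑ x, quadC F x * ψ (a * x) = quadC F a * gaussSum (quadC F) ψ := by
  rcases eq_or_ne a 0 with rfl | ha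
  · simp [sum_quadC hF, MulChar.map_zero]
  · have h := gaussSum_mulShift (quadC F) ψ (Units.mk0 a ha)
    have h1 : quadC F a * quadC F a = 1 := by
      rw [← sq, quadC_apply]
      exact_mod_cast quadraticChar_sq_one ha
    rw [Units.val_mk0, gaussSum] at h
    rw [← h, ← mul_assoc, h1, one_mul]
    rfl

lemma sum_addChar_mul_sq (hF : ringChar F ≠ 2) (hψ : ψ.IsPrimitive) {a : F} (ha : a ≠ 0) :
    ∑ x, ψ (a * x ^ 2) = quadC F a * gaussSum (quadC F) ψ := by
  have h1 : ∀ x, ψ (a * x ^ 2) = ∑ y, (if x ^ 2 = y then (1 : ℂ) else 0) * ψ (a * y) := by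
    intro x
    simp
  rw [Finset.sum_congr rfl fun x _ => h1 x, Finset.sum_comm, ← sum_quadC_mul_mulShift hF]
  have h2 : ∀ y : F, ∑ x, (if x ^ 2 = y then (1 : ℂ) else 0) = 1 + quadC F y := by
    intro y
    have := congrArg (Int.cast : ℤ → ℂ) (sum_ite_sq_eq hF y)
    push_cast at this
    exact this
  simp only [← Finset.sum_mul, h2, add_mul, one_mul, Finset.sum_add_distrib]
  have h3 := AddChar.sum_mulShift a hψ
  rw [if_neg ha] at h3
  simp only [mul_comm a] at *
  simp [h3]

variable {K : Type*} [Field K] [Fintype K] [DecidableEq K] [Algebra F K] {k : ℕ}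

lemma traceChar_algebraMap_mul {F K : Type*} [Field F] [Field K] [Algebra F K] (ψ : AddChar F ℂ)
    (v : F) (x : K) :
    traceChar ψ K (algebraMap F K v * x) = ψ (v * Algebra.trace F K x) := by
  rw [traceChar_apply, ← Algebra.smul_def, map_smul, smul_eq_mul]

lemma quadC_algebraMap (hF : ringChar F ≠ 2) (hodd : Odd (Module.finrank F K)) (y : F) :
    quadC K (algebraMap F K y) = quadC F y := by
  rw [quadC_apply, quadC_apply, quadraticChar_algebraMap hF hodd]

lemma quadC_neg_one_mul_self : quadC F (-1) * quadC F (-1) = 1 := by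
  rw [← map_mul]
  simp

/-- The sum of the quadratic character over the elements of trace `b`. -/
lemma card_mul_sum_quadC_trace_eq (hF : ringChar F ≠ 2) (hψ : ψ.IsPrimitive) (hk : k.Prime)
    (hodd : Odd k) (hfin : Module.finrank F K = k) (b : F) :
    (Fintype.card F : ℂ) * ∑ z : K, (if Algebra.trace F K z = b then quadC K z else 0)
      = (∑ v, quadC F v * ψ (-(v * b))) * gaussSum (quadC F) ψ ^ k := by
  have hK : ringChar K ≠ 2 := by rwa [ringChar_eq_of_algebra (F := F)]
  have h1 : ∀ z : K, (Fintype.card F : ℂ) * (if Algebra.trace F K z = b then quadC K z else 0)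
      = ∑ v, ψ (-(v * b)) * (quadC K z * traceChar ψ K (algebraMap F K v * z)) := by
    intro z
    have := card_mul_ite_eq hψ (Algebra.trace F K z) b
    rw [← mul_one (quadC K z), ← mul_ite_zero, mul_left_comm, this, Finset.mul_sum]
    refine Finset.sum_congr rfl fun v _ => ?_
    rw [traceChar_algebraMap_mul]
    ring
  rw [Finset.mul_sum, Finset.sum_congr rfl fun z _ => h1 z, Finset.sum_comm, Finset.sum_mul,
    ← gaussSum_traceChar (K := K) hF hk hodd hfin]
  refine Finset.sum_congr rfl fun v _ => ?_
  rw [← Finset.mul_sum, sum_quadC_mul_mulShift hK, quadC_algebraMap hF (by rwa [hfin])]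
  ring

lemma sum_quadC_trace_eq_zero (hF : ringChar F ≠ 2) (hψ : ψ.IsPrimitive) (hk : k.Prime)
    (hodd : Odd k) (hfin : Module.finrank F K = k) :
    ∑ z : K, (if Algebra.trace F K z = 0 then quadC K z else 0) = 0 := by
  have h := card_mul_sum_quadC_trace_eq (K := K) hF hψ hk hodd hfin 0
  simp only [mul_zero, neg_zero, AddChar.map_zero_eq_one, mul_one, sum_quadC hF, zero_mul,
    mul_eq_zero] at h
  exact h.resolve_left (by simp)

lemma card_mul_sum_quadC_trace_eq_one (hF : ringChar F ≠ 2) (hψ : ψ.IsPrimitive) (hk : k.Prime)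
    (hodd : Odd k) (hfin : Module.finrank F K = k) :
    (Fintype.card F : ℂ) * ∑ z : K, (if Algebra.trace F K z = 1 then quadC K z else 0)
      = quadC F (-1) * gaussSum (quadC F) ψ ^ (k + 1) := by
  rw [card_mul_sum_quadC_trace_eq (K := K) hF hψ hk hodd hfin 1]
  have := sum_quadC_mul_mulShift (ψ := ψ) hF (-1)
  simp only [mul_one, neg_one_mul] at this ⊢
  rw [this]
  ring

lemma card_mul_card_trace_eq_zero (hψ : ψ.IsPrimitive) (hfin : Module.finrank F K = k) :
    (Fintype.card F : ℂ) * ∑ z : K, (if Algebra.trace F K z = 0 then (1 : ℂ) else 0)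
      = (Fintype.card F : ℂ) ^ k := by
  have hcard : (Fintype.card K : ℂ) = (Fintype.card F : ℂ) ^ k := by
    rw [← hfin]
    exact_mod_cast Module.card_eq_pow_finrank (K := F) (V := K)
  rw [Finset.mul_sum]
  simp only [card_mul_ite_eq hψ, mul_zero, neg_zero, AddChar.map_zero_eq_one, mul_one,
    ← traceChar_algebraMap_mul]
  rw [Finset.sum_comm]
  have h := fun b : F => AddChar.sum_mulShift (algebraMap F K b) (traceChar_isPrimitive (K := K) hψ)
  simp only [mul_comm _ (algebraMap F K _), map_eq_zero] at h
  simp only [h]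
  simp [hcard]

end CharacterSums

lemma sum_comp_add_right {G R : Type*} [AddGroup G] [Fintype G] [AddCommMonoid R] (f : G → R)
    (a : G) : ∑ x, f (x + a) = ∑ x, f x :=
  Fintype.sum_equiv (Equiv.addRight a) _ _ fun _ => rfl

section ConicCount

variable {F : Type*} [Field F] [Fintype F] [DecidableEq F] {ψ : AddChar F ℂ}
  {K : Type*} [Field K] [Fintype K] [DecidableEq K] [Algebra F K] {k : ℕ}

lemma ringChar_ne_two_of_algebra {F : Type*} [Field F] (K : Type*) [Field K] [Algebra F K]
    (hF : ringChar F ≠ 2) : ringChar K ≠ 2 := by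
  rwa [ringChar_eq_of_algebra (F := F)]

lemma sum_traceChar_quadratic (hF : ringChar F ≠ 2) (hψ : ψ.IsPrimitive) (hk : k.Prime)
    (hodd : Odd k) (hfin : Module.finrank F K = k) {z : K} (hz : z ≠ 0)
    (htr : Algebra.trace F K z = 0) {v : F} (hv : v ≠ 0) (u : F) :
    ∑ x : K, traceChar ψ K (algebraMap F K u * (z * x) + algebraMap F K v * (z * x ^ 2))
      = quadC F v * quadC K z * gaussSum (quadC F) ψ ^ k := by
  have hsq : ∀ x : K, traceChar ψ K (algebraMap F K u * (z * x) + algebraMap F K v * (z * x ^ 2))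
      = traceChar ψ K (algebraMap F K v * z * (x + algebraMap F K (u / (2 * v))) ^ 2) := by
    intro x
    have e : algebraMap F K v * z * (x + algebraMap F K (u / (2 * v))) ^ 2
        = (algebraMap F K u * (z * x) + algebraMap F K v * (z * x ^ 2))
          + algebraMap F K (u ^ 2 / (4 * v)) * z := by
      have h2' : (2 : K) ≠ 0 := Ring.two_ne_zero (ringChar_ne_two_of_algebra K hF)
      have h4' : (4 : K) ≠ 0 := by
        rw [show (4 : K) = 2 * 2 by norm_num]; exact mul_ne_zero h2' h2'
      have hv' : algebraMap F K v ≠ 0 := by simpa using hv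
      simp only [map_div₀, map_mul, map_pow, map_ofNat]
      field_simp
      ring
    rw [e, AddChar.map_add_eq_mul _ (_ + _), traceChar_algebraMap_mul _ (u ^ 2 / (4 * v)), htr,
      mul_zero, AddChar.map_zero_eq_one, mul_one]
  rw [Finset.sum_congr rfl fun x _ => hsq x,
    sum_comp_add_right (fun x => traceChar ψ K (algebraMap F K v * z * x ^ 2)),
    sum_addChar_mul_sq (ringChar_ne_two_of_algebra K hF) (traceChar_isPrimitive hψ)
      (mul_ne_zero (by simpa using hv) hz),
    gaussSum_traceChar hF hk hodd hfin, map_mul, quadC_algebraMap hF (by rwa [hfin])]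

lemma sum_traceChar_linear (hψ : ψ.IsPrimitive) (hfin : Module.finrank F K = k) {z : K}
    (hz : z ≠ 0) (u : F) :
    ∑ x : K, traceChar ψ K (algebraMap F K u * (z * x))
      = if u = 0 then (Fintype.card F : ℂ) ^ k else 0 := by
  have hcard : (Fintype.card K : ℂ) = (Fintype.card F : ℂ) ^ k := by
    rw [← hfin]
    exact_mod_cast Module.card_eq_pow_finrank (K := F) (V := K)
  have h := AddChar.sum_mulShift (algebraMap F K u * z) (traceChar_isPrimitive (K := K) hψ)
  simp only [mul_comm _ (algebraMap F K u * z), mul_assoc, mul_eq_zero, map_eq_zero, hz,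
    or_false] at h
  rw [h]
  split_ifs
  · exact hcard
  · simp

lemma card_sq_mul_sum_conic (hF : ringChar F ≠ 2) (hψ : ψ.IsPrimitive) (hk : k.Prime)
    (hodd : Odd k) (hfin : Module.finrank F K = k) {z : K} (hz : z ≠ 0)
    (htr : Algebra.trace F K z = 0) :
    (Fintype.card F : ℂ) ^ 2 * ∑ x : K, (if Algebra.trace F K (z * x) = 0 ∧
        Algebra.trace F K (z * x ^ 2) = 1 then (1 : ℂ) else 0)
      = (Fintype.card F : ℂ) ^ k
        + Fintype.card F * (quadC F (-1) * quadC K z * gaussSum (quadC F) ψ ^ (k + 1)) := by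
  have h1 : ∀ x : K, (Fintype.card F : ℂ) ^ 2 * (if Algebra.trace F K (z * x) = 0 ∧
        Algebra.trace F K (z * x ^ 2) = 1 then (1 : ℂ) else 0)
      = ∑ v, ∑ u, ψ (-v) *
        traceChar ψ K (algebraMap F K u * (z * x) + algebraMap F K v * (z * x ^ 2)) := by
    intro x
    rw [← mul_one (1 : ℂ), ← ite_zero_mul_ite_zero, sq, mul_mul_mul_comm, card_mul_ite_eq hψ,
      card_mul_ite_eq hψ, mul_comm, Finset.sum_mul_sum]
    refine Finset.sum_congr rfl fun v _ => Finset.sum_congr rfl fun u _ => ?_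
    rw [AddChar.map_add_eq_mul, traceChar_algebraMap_mul, traceChar_algebraMap_mul]
    simp
    ring
  rw [Finset.mul_sum, Finset.sum_congr rfl fun x _ => h1 x, Finset.sum_comm]
  have h2 : ∀ v : F, ∑ x : K, ∑ u, ψ (-v) *
        traceChar ψ K (algebraMap F K u * (z * x) + algebraMap F K v * (z * x ^ 2))
      = (if v = 0 then (Fintype.card F : ℂ) ^ k else 0) + Fintype.card F * (quadC F v * ψ (-1 * v))
        * (quadC K z * gaussSum (quadC F) ψ ^ k) := by
    intro v
    rw [Finset.sum_comm]
    simp only [← Finset.mul_sum]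
    rcases eq_or_ne v 0 with rfl | hv
    · simp [sum_traceChar_linear hψ hfin hz, MulChar.map_zero]
    · simp only [sum_traceChar_quadratic hF hψ hk hodd hfin hz htr hv, if_neg hv]
      simp
      ring
  rw [Finset.sum_congr rfl fun v _ => h2 v, Finset.sum_add_distrib, ← Finset.sum_mul,
    ← Finset.mul_sum, sum_quadC_mul_mulShift hF]
  simp
  ring

end ConicCount

section TraceSums

variable {F : Type*} [Field F] [Fintype F] [DecidableEq F] {ψ : AddChar F ℂ}
  {K : Type*} [Field K] [Fintype K] [DecidableEq K] [Algebra F K]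

lemma sum_quadraticChar_trace_five (hF : ringChar F ≠ 2) (hψ : ψ.IsPrimitive)
    (hfin : Module.finrank F K = 5) :
    ∑ z : K, (if Algebra.trace F K z = 1 then quadraticChar K z else 0)
      = (Fintype.card F : ℤ) ^ 2 := by
  have h := card_mul_sum_quadC_trace_eq_one (K := K) hF hψ Nat.prime_five (by decide) hfin
  have hq : (Fintype.card F : ℂ) ≠ 0 := by simp
  have h1 := quadC_neg_one_mul_self (F := F)
  have h2 := gaussSum_quadC_sq hF hψ
  have h3 : ∑ z : K, (if Algebra.trace F K z = 1 then quadC K z else 0)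
      = (Fintype.card F : ℂ) ^ 2 := by
    apply mul_left_cancel₀ hq
    rw [h, show 5 + 1 = 2 * 3 by norm_num, pow_mul, h2]
    linear_combination (quadC F (-1) ^ 2 + 1) * (Fintype.card F : ℂ) ^ 3 * h1
  simp only [quadC_apply] at h3
  exact_mod_cast h3

lemma sum_quadraticChar_conic_seven (hF : ringChar F ≠ 2) (hψ : ψ.IsPrimitive)
    (hfin : Module.finrank F K = 7) :
    ∑ x : K, ∑ z : K, (if Algebra.trace F K z = 0 ∧ Algebra.trace F K (z * x) = 0 ∧
        Algebra.trace F K (z * x ^ 2) = 1 then quadraticChar K z else 0)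
      = quadraticChar F (-1) * ((Fintype.card F : ℤ) ^ 9 - (Fintype.card F : ℤ) ^ 3) := by
  have hq : (Fintype.card F : ℂ) ≠ 0 := by simp
  have h1 := quadC_neg_one_mul_self (F := F)
  have h2 := gaussSum_quadC_sq hF hψ
  have key : ∀ z : K, (Fintype.card F : ℂ) * ∑ x : K, (if Algebra.trace F K z = 0 ∧
        Algebra.trace F K (z * x) = 0 ∧
        Algebra.trace F K (z * x ^ 2) = 1 then quadC K z else 0)
      = (Fintype.card F : ℂ) ^ 6 * (if Algebra.trace F K z = 0 then quadC K z else 0)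
        + (Fintype.card F : ℂ) ^ 4 * quadC F (-1) *
          ((if Algebra.trace F K z = 0 then 1 else 0) - if z = 0 then 1 else 0) := by
    intro z
    rcases eq_or_ne z 0 with rfl | hz
    · simp [MulChar.map_zero]
    by_cases htr : Algebra.trace F K z = 0
    · have h := card_sq_mul_sum_conic (K := K) hF hψ Nat.prime_seven (by decide) hfin hz htr
      have hz2 : quadC K z * quadC K z = 1 := by
        rw [← sq, quadC_apply]
        exact_mod_cast quadraticChar_sq_one hz
      have e : ∀ x : K, (if Algebra.trace F K z = 0 ∧ Algebra.trace F K (z * x) = 0 ∧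
          Algebra.trace F K (z * x ^ 2) = 1 then quadC K z else 0)
          = quadC K z * (if Algebra.trace F K (z * x) = 0 ∧
            Algebra.trace F K (z * x ^ 2) = 1 then 1 else 0) := by
        intro x
        simp [htr]
      rw [Finset.sum_congr rfl fun x _ => e x, ← Finset.mul_sum, if_pos htr, if_pos htr,
        if_neg hz]
      rw [show 7 + 1 = 2 * 4 by norm_num, pow_mul, h2] at h
      apply mul_left_cancel₀ hq
      linear_combination quadC K z * h + (Fintype.card F : ℂ) ^ 5 * quadC F (-1) *
        (quadC F (-1) ^ 2 + 1) * h1 * (quadC K z * quadC K z)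
        + (Fintype.card F : ℂ) ^ 5 * quadC F (-1) * hz2
    · simp [htr, hz]
  have h3 : ∑ x : K, ∑ z : K, (if Algebra.trace F K z = 0 ∧ Algebra.trace F K (z * x) = 0 ∧
        Algebra.trace F K (z * x ^ 2) = 1 then quadC K z else 0)
      = quadC F (-1) * ((Fintype.card F : ℂ) ^ 9 - (Fintype.card F : ℂ) ^ 3) := by
    have h4 := card_mul_card_trace_eq_zero (K := K) hψ hfin
    apply mul_left_cancel₀ hq
    rw [Finset.sum_comm, Finset.mul_sum, Finset.sum_congr rfl fun z _ => key z,
      Finset.sum_add_distrib, ← Finset.mul_sum, ← Finset.mul_sum, Finset.sum_sub_distrib,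
      sum_quadC_trace_eq_zero hF hψ Nat.prime_seven (by decide) hfin]
    simp only [Finset.sum_ite_eq', Finset.mem_univ, if_true]
    linear_combination (Fintype.card F : ℂ) ^ 3 * quadC F (-1) * h4
  simp only [quadC_apply] at h3
  exact_mod_cast h3

end TraceSums

section QuarticSums

variable {F : Type*} [Field F] [Fintype F] [DecidableEq F] {ψ : AddChar F ℂ}
  {K : Type*} [Field K] [Fintype K] [DecidableEq K] [Algebra F K]

/-- The value of a monic quartic polynomial with given lower coefficients. -/
def quarticValue {F K : Type*} [Field F] [Field K] [Algebra F K] (c : Fin 4 → F) (x : K) : K :=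
  (∑ i, algebraMap F K (c i) * x ^ (i : ℕ)) + x ^ 4

lemma sum_quarticValue_of_mem_range (hF : ringChar F ≠ 2) (hodd : Odd (Module.finrank F K)) {x : K}
    (hx : x ∈ (algebraMap F K).range) :
    ∑ c : Fin 4 → F, quadraticChar K (quarticValue c x) = 0 := by
  obtain ⟨r, rfl⟩ := hx
  rw [sum_fin_succ_cons, Finset.sum_comm]
  refine Finset.sum_eq_zero fun c _ => ?_
  rw [← quadraticChar_sum_zero hF,
    ← sum_comp_add_right (fun a => quadraticChar F a) ((∑ i, c i * r ^ ((i : ℕ) + 1)) + r ^ 4)]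
  refine Finset.sum_congr rfl fun a _ => ?_
  rw [← quadraticChar_algebraMap (K := K) hF hodd, quarticValue, Fin.sum_univ_succ]
  simp [add_assoc]

lemma sum_quarticValue_of_finrank_one (hF : ringChar F ≠ 2) :
    ∑ c : Fin 4 → F, ∑ x : F, quadraticChar F (quarticValue c x) = 0 := by
  rw [Finset.sum_comm]
  exact Finset.sum_eq_zero fun x _ =>
    sum_quarticValue_of_mem_range hF (by simp) ⟨x, rfl⟩

lemma sum_quarticValue_of_finrank_three (hF : ringChar F ≠ 2) (hfin : Module.finrank F K = 3) :
    ∑ c : Fin 4 → F, ∑ x : K, quadraticChar K (quarticValue c x) = 0 := by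
  rw [Finset.sum_comm]
  refine Finset.sum_eq_zero fun x _ => ?_
  by_cases hx : x ∈ (algebraMap F K).range
  · exact sum_quarticValue_of_mem_range hF (by rw [hfin]; decide) hx
  rw [sum_fin_succ_snoc]
  refine Finset.sum_eq_zero fun a _ => ?_
  rw [← quadraticChar_sum_zero (ringChar_ne_two_of_algebra K hF),
    ← sum_comp_add_right _ (algebraMap F K a * x ^ 3 + x ^ 4),
    sum_eq_sum_pow_basis Nat.prime_three hfin hx]
  refine Finset.sum_congr rfl fun c _ => ?_
  rw [quarticValue, Fin.sum_univ_castSucc]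
  simp only [Fin.snoc_castSucc, Fin.snoc_last, Fin.val_castSucc, Fin.val_last, add_assoc]

lemma sum_eq_of_const_off_range {F K : Type*} [Field F] [Fintype F] [Field K] [Fintype K]
    [Algebra F K] {k : ℕ} (hfin : Module.finrank F K = k)
    (g : K → ℤ) (C : ℤ) (h0 : ∀ x ∈ (algebraMap F K).range, g x = 0)
    (hC : ∀ x ∉ (algebraMap F K).range, g x = C) :
    ∑ x, g x = C * ((Fintype.card F : ℤ) ^ k - Fintype.card F) := by
  classical
  have h1 : ∀ x : K, g x = C - C * ∑ r : F, if algebraMap F K r = x then 1 else 0 := by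
    intro x
    by_cases hx : x ∈ (algebraMap F K).range
    · rw [h0 x hx]
      obtain ⟨r, rfl⟩ := hx
      simp
    · rw [hC x hx, Finset.sum_eq_zero fun r _ => if_neg fun h => hx ⟨r, h⟩]
      ring
  rw [Finset.sum_congr rfl fun x _ => h1 x, Finset.sum_sub_distrib, ← Finset.mul_sum,
    Finset.sum_comm]
  simp [Module.card_eq_pow_finrank (K := F) (V := K), hfin]
  ring

lemma trace_mul_algebraMap_mul {F K : Type*} [Field F] [Field K] [Algebra F K] (w y : K) (a : F) :
    Algebra.trace F K (w * (algebraMap F K a * y)) = a * Algebra.trace F K (w * y) := by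
  rw [mul_left_comm, ← Algebra.smul_def, map_smul, smul_eq_mul]

lemma trace_mul_sum {F K : Type*} [Field F] [Field K] [Algebra F K] {n : ℕ} (w x : K)
    (c : Fin n → F) :
    Algebra.trace F K (w * ∑ i, algebraMap F K (c i) * x ^ (i : ℕ))
      = ∑ i, c i * Algebra.trace F K (w * x ^ (i : ℕ)) := by
  rw [Finset.mul_sum, map_sum]
  exact Finset.sum_congr rfl fun i _ => trace_mul_algebraMap_mul _ _ _

lemma sum_quarticValue_five_of_notMem_range (hF : ringChar F ≠ 2) (hψ : ψ.IsPrimitive)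
    (hfin : Module.finrank F K = 5) {x : K} (hx : x ∉ (algebraMap F K).range) :
    ∑ c : Fin 4 → F, quadraticChar K (quarticValue c x) = (Fintype.card F : ℤ) ^ 2 := by
  set d := aeval x (derivative (minpoly F x)) with hd
  have hd0 : d ≠ 0 := aeval_derivative_minpoly_ne_zero x
  have htr := fun i (hi : i < 5) => trace_pow_div_derivative Nat.prime_five hfin hx hi
  rw [← hd] at htr
  have h1 : ∑ z : K, (if Algebra.trace F K (d⁻¹ * z) = 1 then quadraticChar K z else 0)
      = (Fintype.card F : ℤ) ^ 2 := by
    rw [← sum_quadraticChar_trace_five (K := K) hF hψ hfin]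
    refine Fintype.sum_equiv (Equiv.mulLeft₀ d⁻¹ (inv_ne_zero hd0)) _ _ fun z => ?_
    rw [Equiv.mulLeft₀_apply]
    congr 1
    nth_rw 1 [← mul_inv_cancel_left₀ hd0 z]
    rw [map_mul, hd, quadraticChar_derivative_minpoly_five hF hfin hx, one_mul]
  rw [sum_eq_sum_pow_basis Nat.prime_five hfin hx, sum_fin_succ_snoc] at h1
  have h2 : ∀ (a : F) (c : Fin 4 → F), Algebra.trace F K
      (d⁻¹ * ((∑ i, algebraMap F K (c i) * x ^ (i : ℕ)) + algebraMap F K a * x ^ 4)) = a := by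
    intro a c
    rw [mul_add, map_add, trace_mul_sum, trace_mul_algebraMap_mul, htr 4 (by norm_num), if_pos rfl,
      mul_one, Finset.sum_eq_zero, zero_add]
    intro i _
    rw [htr i (by omega), if_neg (by omega), mul_zero]
  simp only [Fin.sum_univ_castSucc (n := 4), Fin.snoc_castSucc, Fin.snoc_last, Fin.val_castSucc,
    Fin.val_last, h2] at h1
  rw [← h1, Finset.sum_comm]
  simp [quarticValue]

lemma sum_quarticValue_of_finrank_five (hF : ringChar F ≠ 2) (hψ : ψ.IsPrimitive)
    (hfin : Module.finrank F K = 5) :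
    ∑ c : Fin 4 → F, ∑ x : K, quadraticChar K (quarticValue c x)
      = (Fintype.card F : ℤ) ^ 7 - (Fintype.card F : ℤ) ^ 3 := by
  rw [Finset.sum_comm, sum_eq_of_const_off_range hfin _ ((Fintype.card F : ℤ) ^ 2)
    (fun x hx => sum_quarticValue_of_mem_range hF (by rw [hfin]; decide) hx)
    (fun x hx => sum_quarticValue_five_of_notMem_range hF hψ hfin hx)]
  ring

lemma sum_quarticValue_seven_of_notMem_range (hF : ringChar F ≠ 2)
    (hfin : Module.finrank F K = 7) {x : K} (hx : x ∉ (algebraMap F K).range) :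
    ∑ c : Fin 4 → F, quadraticChar K (quarticValue c x)
      = quadraticChar F (-1) * ∑ z : K, (if Algebra.trace F K z = 0 ∧
        Algebra.trace F K (z * x) = 0 ∧ Algebra.trace F K (z * x ^ 2) = 1
        then quadraticChar K z else 0) := by
  set d := aeval x (derivative (minpoly F x)) with hd
  have hd0 : d ≠ 0 := aeval_derivative_minpoly_ne_zero x
  have htr := fun i (hi : i < 7) => trace_pow_div_derivative Nat.prime_seven hfin hx hi
  rw [← hd] at htr
  have hneg : quadraticChar K (-1) = quadraticChar F (-1) := by
    rw [← quadraticChar_algebraMap (K := K) hF (by rw [hfin]; decide)]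
    simp
  have h1 : ∑ z : K, (if Algebra.trace F K (d⁻¹ * z) = 0 ∧ Algebra.trace F K (d⁻¹ * x * z) = 0 ∧
        Algebra.trace F K (d⁻¹ * x ^ 2 * z) = 1 then quadraticChar K z else 0)
      = quadraticChar F (-1) * ∑ z : K, (if Algebra.trace F K z = 0 ∧
        Algebra.trace F K (z * x) = 0 ∧ Algebra.trace F K (z * x ^ 2) = 1
        then quadraticChar K z else 0) := by
    rw [Finset.mul_sum]
    refine Fintype.sum_equiv (Equiv.mulLeft₀ d⁻¹ (inv_ne_zero hd0)) _ _ fun z => ?_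
    rw [Equiv.mulLeft₀_apply, mul_ite, mul_zero, mul_right_comm _ z x, mul_right_comm _ z (x ^ 2)]
    congr 1
    nth_rw 1 [← mul_inv_cancel_left₀ hd0 z]
    rw [map_mul, hd, quadraticChar_derivative_minpoly_seven hF hfin hx, hneg]
  rw [← h1, sum_eq_sum_pow_basis Nat.prime_seven hfin hx, sum_fin_succ_snoc (n := 6)]
  have hsix : ∀ f : (Fin 6 → F) → ℤ,
      ∑ c, f c = ∑ a₅ : F, ∑ a₄ : F, ∑ c : Fin 4 → F,
        f (Fin.snoc (Fin.snoc c a₄ : Fin 5 → F) a₅) := fun f => by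
    rw [sum_fin_succ_snoc]
    exact Finset.sum_congr rfl fun a _ => sum_fin_succ_snoc _
  simp only [hsix]
  have hlow : ∀ (c : Fin 4 → F) (j : ℕ), j < 3 → Algebra.trace F K
      (d⁻¹ * x ^ j * ∑ i, algebraMap F K (c i) * x ^ (i : ℕ)) = 0 := by
    intro c j hj
    rw [trace_mul_sum]
    refine Finset.sum_eq_zero fun i _ => ?_
    rw [mul_assoc, ← pow_add, htr _ (by omega), if_neg (by omega), mul_zero]
  have hcond : ∀ (c : Fin 4 → F) (a₄ a₅ a₆ : F) (z : K),
      z = (∑ i, algebraMap F K (c i) * x ^ (i : ℕ)) + algebraMap F K a₄ * x ^ 4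
        + algebraMap F K a₅ * x ^ 5 + algebraMap F K a₆ * x ^ 6 →
      ((Algebra.trace F K (d⁻¹ * z) = 0 ∧ Algebra.trace F K (d⁻¹ * x * z) = 0 ∧
        Algebra.trace F K (d⁻¹ * x ^ 2 * z) = 1) ↔ a₆ = 0 ∧ a₅ = 0 ∧ a₄ = 1) := by
    rintro c a₄ a₅ a₆ z rfl
    have e0 := hlow c 0 (by norm_num)
    have e1 := hlow c 1 (by norm_num)
    have e2 := hlow c 2 (by norm_num)
    rw [pow_zero, mul_one] at e0
    rw [pow_one] at e1
    simp only [mul_add, map_add, trace_mul_algebraMap_mul, e0, e1, e2, zero_add]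
    have f4 := htr 4 (by norm_num)
    have f5 := htr 5 (by norm_num)
    have f6 := htr 6 (by norm_num)
    norm_num at f4 f5 f6
    simp only [mul_assoc, ← pow_add, ← pow_succ', Nat.reduceAdd, f4, f5, f6, mul_zero, mul_one,
      zero_add]
    constructor
    · rintro ⟨h6, h5, h4⟩
      subst h6
      simp only [zero_mul, add_zero] at h5 h4
      subst h5
      simpa using h4
    · rintro ⟨rfl, rfl, rfl⟩
      simp
  have hval : ∀ (c : Fin 4 → F) (a₄ a₅ a₆ : F),
      ∑ i : Fin 7, algebraMap F K ((Fin.snoc (Fin.snoc (Fin.snoc c a₄ : Fin 5 → F) a₅ : Fin 6 → F)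
        a₆ : Fin 7 → F) i) * x ^ (i : ℕ)
      = (∑ i, algebraMap F K (c i) * x ^ (i : ℕ)) + algebraMap F K a₄ * x ^ 4
        + algebraMap F K a₅ * x ^ 5 + algebraMap F K a₆ * x ^ 6 := by
    intro c a₄ a₅ a₆
    simp only [Fin.sum_univ_castSucc (n := 6), Fin.sum_univ_castSucc (n := 5),
      Fin.sum_univ_castSucc (n := 4), Fin.snoc_castSucc, Fin.snoc_last, Fin.val_castSucc,
      Fin.val_last]
  simp only [hval, hcond _ _ _ _ _ rfl]
  symm
  rw [Finset.sum_eq_single 0 (fun a _ ha => by simp [ha]) (by simp),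
    Finset.sum_eq_single 0 (fun a _ ha => by simp [ha]) (by simp),
    Finset.sum_eq_single 1 (fun a _ ha => by simp [ha]) (by simp)]
  simp [quarticValue]

lemma sum_quarticValue_of_finrank_seven (hF : ringChar F ≠ 2) (hψ : ψ.IsPrimitive)
    (hfin : Module.finrank F K = 7) :
    ∑ c : Fin 4 → F, ∑ x : K, quadraticChar K (quarticValue c x)
      = (Fintype.card F : ℤ) ^ 9 - (Fintype.card F : ℤ) ^ 3 := by
  have h1 : ∀ x : K, ∑ c : Fin 4 → F, quadraticChar K (quarticValue c x)
      = quadraticChar F (-1) * ∑ z : K, (if Algebra.trace F K z = 0 ∧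
        Algebra.trace F K (z * x) = 0 ∧ Algebra.trace F K (z * x ^ 2) = 1
        then quadraticChar K z else 0) := by
    intro x
    by_cases hx : x ∈ (algebraMap F K).range
    · rw [sum_quarticValue_of_mem_range hF (by rw [hfin]; decide) hx]
      obtain ⟨r, rfl⟩ := hx
      rw [Finset.sum_eq_zero, mul_zero]
      refine fun z _ => if_neg ?_
      rintro ⟨h0, -, h2⟩
      rw [← map_pow, mul_comm, ← Algebra.smul_def, map_smul, h0, smul_zero] at h2
      exact zero_ne_one h2
    · exact sum_quarticValue_seven_of_notMem_range hF hfin hx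
  have h2 := quadraticChar_sq_one (F := F) (neg_ne_zero.2 one_ne_zero)
  rw [Finset.sum_comm, Finset.sum_congr rfl fun x _ => h1 x, ← Finset.mul_sum,
    sum_quadraticChar_conic_seven hF hψ hfin]
  linear_combination ((Fintype.card F : ℤ) ^ 9 - (Fintype.card F : ℤ) ^ 3) * h2

end QuarticSums

section Resolvent

variable {K : Type*} [Field K] [Fintype K] [DecidableEq K]

lemma sum_ite_quadratic (hK : ringChar K ≠ 2) (a b c v : K) :
    ∑ x : K, (if (v / 2 - x ^ 2) ^ 2 = x ^ 4 + a * x ^ 2 + b * x + c then (1 : ℤ) else 0)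
      = 1 + quadraticChar K ((v + a) * (v ^ 2 - 4 * c) + b ^ 2)
        + (if v = -a then -1 + (if b = 0 ∧ a ^ 2 = 4 * c then (Fintype.card K : ℤ) else 0)
          else 0) := by
  have h2 : (2 : K) ≠ 0 := Ring.two_ne_zero hK
  have h4 : (4 : K) ≠ 0 := by rw [show (4 : K) = 2 * 2 by norm_num]; exact mul_ne_zero h2 h2
  have hiff : ∀ x : K, (v / 2 - x ^ 2) ^ 2 = x ^ 4 + a * x ^ 2 + b * x + c ↔
      4 * (v + a) * x ^ 2 + 4 * b * x + 4 * c = v ^ 2 := by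
    intro x
    rw [← mul_right_inj' h4]
    field_simp
    constructor <;> intro h <;> linear_combination -h
  simp only [hiff]
  by_cases hv : v = -a
  · subst hv
    have hD : (-a + a) * ((-a) ^ 2 - 4 * c) + b ^ 2 = b ^ 2 := by ring
    rw [if_pos rfl, hD]
    rcases eq_or_ne b 0 with rfl | hb
    · by_cases hac : a ^ 2 = 4 * c
      · simp [hac]
      · simp [hac, Ne.symm hac]
    · rw [map_pow, quadraticChar_sq_one hb]
      have : ∀ x : K, (4 * (-a + a) * x ^ 2 + 4 * b * x + 4 * c = (-a) ^ 2) ↔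
          x = (a ^ 2 - 4 * c) / (4 * b) := by
        intro x
        rw [eq_div_iff (mul_ne_zero h4 hb)]
        constructor <;> intro h <;> linear_combination h
      simp only [this, Finset.sum_ite_eq', Finset.mem_univ, if_true]
      simp [hb]
  · have hva : v + a ≠ 0 := fun h => hv (eq_neg_of_add_eq_zero_left h)
    rw [if_neg hv, add_zero, ← sum_ite_sq_eq hK]
    refine Fintype.sum_equiv ((Equiv.mulLeft₀ (2 * (v + a)) (mul_ne_zero h2 hva)).trans
      (Equiv.addRight b)) _ _ fun x => ?_
    simp only [Equiv.trans_apply, Equiv.mulLeft₀_apply, Equiv.coe_addRight]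
    congr 1
    rw [eq_iff_iff, ← mul_right_inj' hva]
    constructor <;> intro h <;> linear_combination h

/-- The character sum of a depressed quartic in terms of that of its cubic resolvent. -/
lemma sum_quadraticChar_depressed_quartic (hK : ringChar K ≠ 2) (a b c : K) :
    ∑ x : K, quadraticChar K (x ^ 4 + a * x ^ 2 + b * x + c)
      = ∑ v : K, quadraticChar K ((v + a) * (v ^ 2 - 4 * c) + b ^ 2) - 1
        + (if b = 0 ∧ a ^ 2 = 4 * c then (Fintype.card K : ℤ) else 0) := by
  have h2 : (2 : K) ≠ 0 := Ring.two_ne_zero hK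
  have h1 : ∑ x : K, (1 + quadraticChar K (x ^ 4 + a * x ^ 2 + b * x + c))
      = ∑ v : K, (1 + quadraticChar K ((v + a) * (v ^ 2 - 4 * c) + b ^ 2)
        + (if v = -a then -1 + (if b = 0 ∧ a ^ 2 = 4 * c then (Fintype.card K : ℤ) else 0)
          else 0)) := by
    rw [← Finset.sum_congr rfl fun v _ => sum_ite_quadratic hK a b c v, Finset.sum_comm]
    simp only [← sum_ite_sq_eq hK]
    refine Finset.sum_congr rfl fun x _ => (Fintype.sum_equiv ((Equiv.mulRight₀ (2⁻¹ : K)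
      (inv_ne_zero h2)).trans (Equiv.subRight (x ^ 2))) _ _ fun v => ?_).symm
    simp [div_eq_mul_inv]
  simp only [Finset.sum_add_distrib, Finset.sum_ite_eq', Finset.mem_univ, if_true] at h1
  linarith

end Resolvent

lemma sum_triangular_shift {G R : Type*} [AddGroup G] [Fintype G] [AddCommMonoid R]
    (g : G → G → G → R) (α : G) (β : G → G) (γ : G → G → G) :
    ∑ x, ∑ y, ∑ z, g (x + α) (y + β x) (z + γ x y) = ∑ x, ∑ y, ∑ z, g x y z := by
  have h1 : ∀ x y, ∑ z, g (x + α) (y + β x) (z + γ x y) = ∑ z, g (x + α) (y + β x) z :=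
    fun x y => sum_comp_add_right (g (x + α) (y + β x)) (γ x y)
  have h2 : ∀ x, ∑ y, ∑ z, g (x + α) (y + β x) z = ∑ y, ∑ z, g (x + α) y z :=
    fun x => sum_comp_add_right (fun y => ∑ z, g (x + α) y z) (β x)
  simp only [h1, h2]
  exact sum_comp_add_right (fun x => ∑ y, ∑ z, g x y z) α

section Cubics

variable {F : Type*} [Field F] [Fintype F] [DecidableEq F]
  {K : Type*} [Field K] [Fintype K] [DecidableEq K] [Algebra F K]

/-- The quadratic character sum over `K` of a monic cubic with coefficients in `F`. -/
def cubicSum {F : Type*} [Field F] (K : Type*) [Field K] [Fintype K] [DecidableEq K] [Algebra F K]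
    (a₂ a₄ a₆ : F) : ℤ :=
  ∑ v : K, quadraticChar K
    (v ^ 3 + algebraMap F K a₂ * v ^ 2 + algebraMap F K a₄ * v + algebraMap F K a₆)

lemma cubicSum_translate {F : Type*} [Field F] [Algebra F K] (a₂ a₄ a₆ e : F) :
    cubicSum K (a₂ + 3 * e) (a₄ + (2 * a₂ * e + 3 * e ^ 2)) (a₆ + (a₄ * e + a₂ * e ^ 2 + e ^ 3))
      = cubicSum K a₂ a₄ a₆ := by
  rw [cubicSum, cubicSum, ← sum_comp_add_right (fun v : K => quadraticChar K
    (v ^ 3 + algebraMap F K a₂ * v ^ 2 + algebraMap F K a₄ * v + algebraMap F K a₆))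
    (algebraMap F K e)]
  refine Finset.sum_congr rfl fun v _ => congrArg _ ?_
  simp only [map_add, map_mul, map_pow, map_ofNat]
  ring

lemma cubicSum_twist (hF : ringChar F ≠ 2) (hodd : Odd (Module.finrank F K)) {d : F} (hd : d ≠ 0)
    (a₂ a₄ a₆ : F) :
    cubicSum K (d * a₂) (d ^ 2 * a₄) (d ^ 3 * a₆)
      = quadraticChar F d * cubicSum K a₂ a₄ a₆ := by
  have hd' : algebraMap F K d ≠ 0 := by simpa using hd
  rw [cubicSum, cubicSum, Finset.mul_sum]
  refine (Fintype.sum_equiv (Equiv.mulLeft₀ (algebraMap F K d) hd') _ _ fun v => ?_).symm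
  have h1 : quadraticChar F d = quadraticChar K (algebraMap F K d ^ 3) := by
    rw [← map_pow, quadraticChar_algebraMap hF hodd, map_pow, pow_succ, quadraticChar_sq_one hd,
      one_mul]
  rw [h1, ← map_mul, Equiv.mulLeft₀_apply]
  congr 1
  simp only [map_mul, map_pow]
  ring

lemma sum_cubicSum (hF : ringChar F ≠ 2) (hodd : Odd (Module.finrank F K)) :
    ∑ a₂ : F, ∑ a₄ : F, ∑ a₆ : F, cubicSum K a₂ a₄ a₆ = 0 := by
  obtain ⟨d, hd⟩ := quadraticChar_exists_neg_one hF
  have hd0 : d ≠ 0 := by rintro rfl; simp at hd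
  have h : ∑ a₂ : F, ∑ a₄ : F, ∑ a₆ : F, cubicSum K (d * a₂) (d ^ 2 * a₄) (d ^ 3 * a₆)
      = ∑ a₂ : F, ∑ a₄ : F, ∑ a₆ : F, cubicSum K a₂ a₄ a₆ := by
    refine Fintype.sum_equiv (Equiv.mulLeft₀ d hd0) _ _ fun a₂ =>
      Fintype.sum_equiv (Equiv.mulLeft₀ (d ^ 2) (pow_ne_zero 2 hd0)) _ _ fun a₄ =>
      Fintype.sum_equiv (Equiv.mulLeft₀ (d ^ 3) (pow_ne_zero 3 hd0)) _ _ fun a₆ => rfl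
  simp only [cubicSum_twist hF hodd hd0, hd, ← Finset.mul_sum] at h
  linarith

end Cubics

lemma sum_fin_four {F R : Type*} [Fintype F] [AddCommMonoid R] (f : (Fin 4 → F) → R) :
    ∑ c, f c = ∑ d, ∑ a, ∑ b, ∑ c, f ![c, b, a, d] := by
  rw [sum_fin_succ_snoc]
  refine Finset.sum_congr rfl fun d _ => ?_
  rw [sum_fin_succ_snoc]
  refine Finset.sum_congr rfl fun a _ => ?_
  rw [sum_fin_succ_snoc]
  refine Finset.sum_congr rfl fun b _ => ?_
  rw [sum_fin_succ_snoc]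
  refine Finset.sum_congr rfl fun c _ => ?_
  rw [Fintype.sum_unique]
  congr 1
  funext i
  fin_cases i <;> rfl

section Correlation

variable {F : Type*} [Field F] [Fintype F] [DecidableEq F]
  {K : Type*} [Field K] [Fintype K] [DecidableEq K] [Algebra F K] {k : ℕ}

lemma four_ne_zero_of_ringChar {F : Type*} [Field F] (hF : ringChar F ≠ 2) : (4 : F) ≠ 0 := by
  have h2 : (2 : F) ≠ 0 := Ring.two_ne_zero hF
  rw [show (4 : F) = 2 * 2 by norm_num]
  exact mul_ne_zero h2 h2

/-- The sum over all quartics reduces to a sum over the depressed ones. -/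
lemma sum_quarticValue_eq_depressed {F : Type*} [Field F] [Fintype F] [Algebra F K]
    (hF : ringChar F ≠ 2) :
    ∑ c : Fin 4 → F, ∑ x : K, quadraticChar K (quarticValue c x)
      = Fintype.card F * ∑ a : F, ∑ b : F, ∑ c : F, ∑ x : K, quadraticChar K
        (x ^ 4 + algebraMap F K a * x ^ 2 + algebraMap F K b * x + algebraMap F K c) := by
  have h4 := four_ne_zero_of_ringChar hF
  rw [sum_fin_four, ← smul_eq_mul, Nat.cast_smul_eq_nsmul, ← Finset.card_univ, ← Finset.sum_const]
  refine Finset.sum_congr rfl fun d _ => ?_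
  obtain ⟨e, rfl⟩ : ∃ e, d = 4 * e := ⟨d / 4, by field_simp⟩
  symm
  rw [← sum_triangular_shift _ (-6 * e ^ 2) (fun a => 8 * e ^ 3 - 2 * a * e)
    fun a b => -3 * e ^ 4 + a * e ^ 2 - b * e]
  refine Finset.sum_congr rfl fun a _ => Finset.sum_congr rfl fun b _ =>
    Finset.sum_congr rfl fun c _ => ?_
  rw [← sum_comp_add_right (fun x : K => quadraticChar K (quarticValue _ x)) (-algebraMap F K e)]
  refine Finset.sum_congr rfl fun x _ => congrArg _ ?_
  simp only [quarticValue, Fin.sum_univ_four, Matrix.cons_val, map_add, map_sub, map_mul, map_pow,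
    map_neg, map_ofNat, Fin.coe_ofNat_eq_mod]
  ring

lemma card_eq_pow_of_finrank {F K : Type*} [Field F] [Fintype F] [Field K] [Fintype K] [Algebra F K]
    (hfin : Module.finrank F K = k) :
    (Fintype.card K : ℤ) = (Fintype.card F : ℤ) ^ k := by
  rw [← hfin]
  exact_mod_cast Module.card_eq_pow_finrank (K := F) (V := K)

lemma sum_depressed_eq_cubicSum (hF : ringChar F ≠ 2) (hfin : Module.finrank F K = k) :
    ∑ a : F, ∑ b : F, ∑ c : F, ∑ x : K, quadraticChar K
        (x ^ 4 + algebraMap F K a * x ^ 2 + algebraMap F K b * x + algebraMap F K c)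
      = ∑ a : F, ∑ b : F, ∑ c : F, (cubicSum K a c (b ^ 2 + a * c) - 1)
        + (Fintype.card F : ℤ) ^ (k + 1) := by
  have h4 := four_ne_zero_of_ringChar hF
  have h1 : ∀ a b c : F, ∑ x : K, quadraticChar K
        (x ^ 4 + algebraMap F K a * x ^ 2 + algebraMap F K b * x + algebraMap F K c)
      = cubicSum K a (-4 * c) (b ^ 2 + a * (-4 * c)) - 1
        + (if b = 0 then if a ^ 2 = 4 * c then (Fintype.card F : ℤ) ^ k else 0 else 0) := by
    intro a b c
    rw [sum_quadraticChar_depressed_quartic (ringChar_ne_two_of_algebra K hF), cubicSum,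
      card_eq_pow_of_finrank hfin, ite_and]
    congr 1
    · congr 1
      refine Finset.sum_congr rfl fun v _ => congrArg _ ?_
      simp only [map_add, map_mul, map_pow, map_neg, map_ofNat]
      ring
    · have e1 : algebraMap F K b = 0 ↔ b = 0 := by simp
      have e2 : algebraMap F K a ^ 2 = 4 * algebraMap F K c ↔ a ^ 2 = 4 * c := by
        rw [← (algebraMap F K).injective.eq_iff, map_pow, map_mul, map_ofNat]
      simp only [e1, e2]
  have h2 : ∀ a c : F, a ^ 2 = 4 * c ↔ c = a ^ 2 / 4 := by
    intro a c
    rw [eq_div_iff h4, mul_comm, eq_comm]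
  have h3 : ∀ a b : F, ∑ c : F, (cubicSum K a (-4 * c) (b ^ 2 + a * (-4 * c)) - 1)
      = ∑ c : F, (cubicSum K a c (b ^ 2 + a * c) - 1) := fun a b =>
    Fintype.sum_equiv (Equiv.mulLeft₀ (-4) (neg_ne_zero.2 h4)) _ _ fun c => rfl
  simp only [h1, h2, Finset.sum_add_distrib, h3]
  congr 1
  have h5 : ∀ a b : F, ∑ c : F, (if b = 0 then if c = a ^ 2 / 4 then (Fintype.card F : ℤ) ^ k
      else 0 else 0) = if b = 0 then (Fintype.card F : ℤ) ^ k else 0 := by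
    intro a b
    split_ifs <;> simp
  simp [h5]
  ring

lemma sum_cubic_square_shift (hF : ringChar F ≠ 2) (Φ : F → F → F → ℤ) :
    ∑ a : F, ∑ b : F, ∑ c : F, Φ a c (b ^ 2 + a * c)
      = ∑ a : F, ∑ c : F, ∑ d : F, (1 + quadraticChar F (d - a * c)) * Φ a c d := by
  refine Finset.sum_congr rfl fun a _ => ?_
  rw [Finset.sum_comm]
  refine Finset.sum_congr rfl fun c _ => ?_
  simp only [← sum_ite_sq_eq hF, Finset.sum_mul]
  rw [Finset.sum_comm]
  refine Finset.sum_congr rfl fun b _ => ?_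
  simp [eq_sub_iff_add_eq]

lemma cubicSum_self (a₂ a₄ a₆ : F) :
    cubicSum F a₂ a₄ a₆ = ∑ v : F, quadraticChar F (v ^ 3 + a₂ * v ^ 2 + a₄ * v + a₆) := rfl

/-- Averaging over translations. -/
lemma card_mul_sum_quadraticChar_mul (hF : ringChar F ≠ 2) (Φ : F → F → F → ℤ)
    (hΦ : ∀ a₂ a₄ a₆ e : F, Φ (a₂ + 3 * e) (a₄ + (2 * a₂ * e + 3 * e ^ 2))
      (a₆ + (a₄ * e + a₂ * e ^ 2 + e ^ 3)) = Φ a₂ a₄ a₆) :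
    Fintype.card F * ∑ a : F, ∑ c : F, ∑ d : F, quadraticChar F (d - a * c) * Φ a c d
      = ∑ a : F, ∑ c : F, ∑ d : F, cubicSum F a c d * Φ a c d := by
  have h2 : (2 : F) ≠ 0 := Ring.two_ne_zero hF
  have h1 : ∀ e : F, ∑ a : F, ∑ c : F, ∑ d : F, quadraticChar F (d - a * c) * Φ a c d
      = ∑ a : F, ∑ c : F, ∑ d : F, quadraticChar F
        ((-a - 2 * e) ^ 3 + a * (-a - 2 * e) ^ 2 + c * (-a - 2 * e) + d) * Φ a c d := by
    intro e
    rw [← sum_triangular_shift _ (3 * e) (fun a => 2 * a * e + 3 * e ^ 2)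
      fun a c => c * e + a * e ^ 2 + e ^ 3]
    refine Finset.sum_congr rfl fun a _ => Finset.sum_congr rfl fun c _ =>
      Finset.sum_congr rfl fun d _ => ?_
    rw [hΦ]
    congr 2
    ring
  rw [← smul_eq_mul, Nat.cast_smul_eq_nsmul, ← Finset.card_univ, ← Finset.sum_const,
    Finset.sum_congr rfl fun e _ => h1 e, Finset.sum_comm]
  refine Finset.sum_congr rfl fun a _ => ?_
  rw [Finset.sum_comm]
  refine Finset.sum_congr rfl fun c _ => ?_
  rw [Finset.sum_comm]
  refine Finset.sum_congr rfl fun d _ => ?_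
  rw [← Finset.sum_mul, cubicSum_self]
  congr 1
  refine Fintype.sum_equiv ((Equiv.mulLeft₀ (2 : F) h2).trans (Equiv.subLeft (-a))) _ _ fun e => ?_
  simp

/-- The correlation of the cubic sums over `F` and over `K` in terms of quartic sums. -/
theorem sum_cubicSum_mul_cubicSum (hF : ringChar F ≠ 2) (hodd : Odd k)
    (hfin : Module.finrank F K = k) :
    ∑ a₂ : F, ∑ a₄ : F, ∑ a₆ : F, cubicSum F a₂ a₄ a₆ * cubicSum K a₂ a₄ a₆
      = (Fintype.card F : ℤ) ^ 4 - (Fintype.card F : ℤ) ^ (k + 2)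
        + ∑ c : Fin 4 → F, ∑ x : K, quadraticChar K (quarticValue c x) := by
  have hA := sum_cubicSum (K := K) hF (by rwa [hfin])
  have hB := sum_cubicSum (F := F) (K := F) hF (by simp)
  have hC := card_mul_sum_quadraticChar_mul hF (fun a₂ a₄ a₆ : F => cubicSum K a₂ a₄ a₆ - 1)
    fun a₂ a₄ a₆ e => by rw [cubicSum_translate]
  rw [sum_quarticValue_eq_depressed hF, sum_depressed_eq_cubicSum hF hfin,
    sum_cubic_square_shift hF fun a₂ a₄ a₆ : F => cubicSum K a₂ a₄ a₆ - 1]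
  simp only [add_mul, one_mul, Finset.sum_add_distrib, mul_sub, mul_one,
    Finset.sum_sub_distrib, hA, hB] at hC ⊢
  simp at hC ⊢
  linear_combination -hC

end Correlation

/-- The discriminant of the cubic `v³ + a₂v² + a₄v + a₆`. -/
def cubicDisc {F : Type*} [Field F] (a₂ a₄ a₆ : F) : F :=
  a₂ ^ 2 * a₄ ^ 2 - 4 * a₄ ^ 3 - 4 * a₂ ^ 3 * a₆ - 27 * a₆ ^ 2 + 18 * a₂ * a₄ * a₆

section SingularCubics

variable {F : Type*} [Field F] [Fintype F] [DecidableEq F]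

lemma exists_double_root {F : Type*} [Field F] [Finite F] (hF : ringChar F ≠ 2) {a₂ a₄ a₆ : F}
    (hD : cubicDisc a₂ a₄ a₆ = 0) :
    ∃ r t : F, -(2 * r + t) = a₂ ∧ r ^ 2 + 2 * r * t = a₄ ∧ -(r ^ 2 * t) = a₆ := by
  have h2 : (2 : F) ≠ 0 := Ring.two_ne_zero hF
  have h4 := four_ne_zero_of_ringChar hF
  rw [cubicDisc] at hD
  suffices h : ∃ r : F, 3 * r ^ 2 + 2 * a₂ * r + a₄ = 0 ∧ r ^ 2 * (a₂ + 2 * r) = a₆ by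
    obtain ⟨r, h1, h2⟩ := h
    refine ⟨r, -a₂ - 2 * r, by ring, ?_, ?_⟩
    · linear_combination -h1
    · linear_combination h2
  by_cases hE : a₂ ^ 2 - 3 * a₄ = 0
  · by_cases h3 : (3 : F) = 0
    · have ha2 : a₂ = 0 := by
        rw [h3, zero_mul, sub_zero] at hE
        exact pow_eq_zero_iff two_ne_zero |>.1 hE
      have ha4 : a₄ = 0 := by
        have : 4 * a₄ ^ 3 = 0 := by
          rw [ha2] at hD
          linear_combination -hD - 9 * a₆ ^ 2 * h3
        exact pow_eq_zero_iff three_ne_zero |>.1 ((mul_eq_zero.1 this).resolve_left h4)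
      have : CharP F 3 := by
        have hdvd : ringChar F ∣ 3 := ringChar.dvd (by exact_mod_cast h3)
        rcases (Nat.dvd_prime Nat.prime_three).1 hdvd with h | h
        · exact absurd h CharP.ringChar_ne_one
        · exact ringChar.of_eq h
      have : Fact (Nat.Prime 3) := ⟨Nat.prime_three⟩
      obtain ⟨r, hr⟩ := surjective_frobenius F 3 (-a₆)
      rw [frobenius_def] at hr
      refine ⟨r, ?_, ?_⟩
      · rw [ha2, ha4, h3]; ring
      · rw [ha2]
        linear_combination -hr + r ^ 3 * h3
    · refine ⟨-a₂ / 3, ?_, ?_⟩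
      · field_simp
        linear_combination -hE
      · have h27 : (27 : F) ≠ 0 := by
          rw [show (27 : F) = 3 ^ 3 by norm_num]; exact pow_ne_zero 3 h3
        have ha4 : a₄ = a₂ ^ 2 / 3 := by
          field_simp
          linear_combination -hE
        have : (27 * a₆ - a₂ ^ 3) ^ 2 = 0 := by
          subst ha4
          field_simp at hD
          linear_combination -hD
        have := pow_eq_zero_iff two_ne_zero |>.1 this
        field_simp
        linear_combination -this
  · refine ⟨(9 * a₆ - a₂ * a₄) / (2 * (a₂ ^ 2 - 3 * a₄)), ?_, ?_⟩
    · field_simp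
      linear_combination -9 * hD
    · have hE3 : 4 * (a₂ ^ 2 - 3 * a₄) ^ 3 ≠ 0 := mul_ne_zero h4 (pow_ne_zero 3 hE)
      have key : ∀ E : F, 4 * E ^ 3 ≠ 0 → ∀ N : F, N ^ 2 * (a₂ * E + N) = 4 * E ^ 3 * a₆ →
          (N / (2 * E)) ^ 2 * (a₂ + 2 * (N / (2 * E))) = a₆ := by
        intro E hE3 N h
        have hE : E ≠ 0 := fun h => hE3 (by rw [h]; ring)
        rw [← mul_right_inj' hE3, ← h]
        field_simp
        ring
      exact key _ hE3 _ (by linear_combination (-27 * a₆ + a₂ ^ 3) * hD)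

lemma double_root_injective {F : Type*} [Field F] {r t r' t' : F}
    (h₂ : -(2 * r + t) = -(2 * r' + t')) (h₄ : r ^ 2 + 2 * r * t = r' ^ 2 + 2 * r' * t')
    (h₆ : -(r ^ 2 * t) = -(r' ^ 2 * t')) : r = r' ∧ t = t' := by
  have hr : r = r' := by
    by_contra hne
    have h1 : (r - r') ^ 2 * (r - t') = 0 := by linear_combination -r ^ 2 * h₂ - r * h₄ - h₆
    have h2 : (r' - r) ^ 2 * (r' - t) = 0 := by linear_combination r' ^ 2 * h₂ + r' * h₄ + h₆
    have h1' := (mul_eq_zero.1 h1).resolve_left (pow_ne_zero 2 (sub_ne_zero.2 hne))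
    have h2' := (mul_eq_zero.1 h2).resolve_left (pow_ne_zero 2 (sub_ne_zero.2 (Ne.symm hne)))
    exact hne (by linear_combination -h₂ - h1' + h2')
  subst hr
  exact ⟨rfl, by linear_combination -h₂⟩

/-- Cubics of vanishing discriminant are parametrized by a double root and a third root. -/
lemma sum_cubicDisc_eq_zero (hF : ringChar F ≠ 2) (f : F → F → F → ℤ) :
    ∑ a₂, ∑ a₄, ∑ a₆, (if cubicDisc a₂ a₄ a₆ = 0 then f a₂ a₄ a₆ else 0)
      = ∑ r, ∑ t, f (-(2 * r + t)) (r ^ 2 + 2 * r * t) (-(r ^ 2 * t)) := by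
  have key : ∑ v ∈ Finset.univ.filter (fun v : F × F × F => cubicDisc v.1 v.2.1 v.2.2 = 0),
      f v.1 v.2.1 v.2.2
      = ∑ w : F × F, f (-(2 * w.1 + w.2)) (w.1 ^ 2 + 2 * w.1 * w.2) (-(w.1 ^ 2 * w.2)) := by
    symm
    refine Finset.sum_bij
      (fun w _ => (-(2 * w.1 + w.2), w.1 ^ 2 + 2 * w.1 * w.2, -(w.1 ^ 2 * w.2))) ?_ ?_ ?_ ?_
    · intro w _
      rw [Finset.mem_filter, cubicDisc]
      exact ⟨Finset.mem_univ _, by ring⟩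
    · rintro ⟨r, t⟩ _ ⟨r', t'⟩ _ h
      simp only [Prod.mk.injEq] at h
      obtain ⟨rfl, rfl⟩ := double_root_injective h.1 h.2.1 h.2.2
      rfl
    · rintro ⟨a₂, a₄, a₆⟩ h
      obtain ⟨r, t, rfl, rfl, rfl⟩ := exists_double_root hF (Finset.mem_filter.1 h).2
      exact ⟨(r, t), Finset.mem_univ _, rfl⟩
    · intro w _
      rfl
  rw [Finset.sum_filter] at key
  simpa only [Fintype.sum_prod_type] using key

variable {K : Type*} [Field K] [Fintype K] [DecidableEq K] [Algebra F K] {k : ℕ}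

lemma cubicSum_double_root (hF : ringChar F ≠ 2) (hodd : Odd (Module.finrank F K)) (r t : F) :
    cubicSum K (-(2 * r + t)) (r ^ 2 + 2 * r * t) (-(r ^ 2 * t)) = -quadraticChar F (r - t) := by
  have hK : ringChar K ≠ 2 := ringChar_ne_two_of_algebra K hF
  have h1 : ∀ v : K, quadraticChar K (v ^ 3 + algebraMap F K (-(2 * r + t)) * v ^ 2
      + algebraMap F K (r ^ 2 + 2 * r * t) * v + algebraMap F K (-(r ^ 2 * t)))
      = quadraticChar K (v - algebraMap F K t)
        - (if v = algebraMap F K r then quadraticChar F (r - t) else 0) := by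
    intro v
    have : v ^ 3 + algebraMap F K (-(2 * r + t)) * v ^ 2
      + algebraMap F K (r ^ 2 + 2 * r * t) * v + algebraMap F K (-(r ^ 2 * t))
      = (v - algebraMap F K r) ^ 2 * (v - algebraMap F K t) := by
      simp only [map_add, map_mul, map_pow, map_neg, map_ofNat]
      ring
    rw [this, map_mul, map_pow]
    split_ifs with hv
    · rw [hv, ← map_sub (algebraMap F K) r t, quadraticChar_algebraMap hF hodd, sub_self,
        MulChar.map_zero]
      ring
    · rw [quadraticChar_sq_one (sub_ne_zero.2 hv)]
      ring
  rw [cubicSum, Finset.sum_congr rfl fun v _ => h1 v, Finset.sum_sub_distrib, Finset.sum_ite_eq',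
    if_pos (Finset.mem_univ _)]
  simp only [sub_eq_add_neg]
  rw [sum_comp_add_right (fun v => quadraticChar K v), quadraticChar_sum_zero hK, zero_add]

lemma sum_quadraticChar_sub_sq (r : F) :
    ∑ t : F, quadraticChar F (r - t) * quadraticChar F (r - t) = (Fintype.card F : ℤ) - 1 := by
  have h : ∀ t : F, quadraticChar F (r - t) * quadraticChar F (r - t)
      = 1 - (if t = r then 1 else 0) := by
    intro t
    split_ifs with ht
    · rw [ht, sub_self, MulChar.map_zero]
      ring
    · rw [← sq, quadraticChar_sq_one (sub_ne_zero.2 (Ne.symm ht))]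
      ring
  rw [Finset.sum_congr rfl fun t _ => h t, Finset.sum_sub_distrib, Finset.sum_ite_eq',
    if_pos (Finset.mem_univ _)]
  simp

lemma sum_cubicDisc_ne_zero (hF : ringChar F ≠ 2) (f : F → F → F → ℤ) :
    ∑ a₂, ∑ a₄, ∑ a₆, (if cubicDisc a₂ a₄ a₆ ≠ 0 then f a₂ a₄ a₆ else 0)
      = ∑ a₂, ∑ a₄, ∑ a₆, f a₂ a₄ a₆
        - ∑ r, ∑ t, f (-(2 * r + t)) (r ^ 2 + 2 * r * t) (-(r ^ 2 * t)) := by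
  rw [← sum_cubicDisc_eq_zero hF]
  simp only [← Finset.sum_sub_distrib]
  refine Finset.sum_congr rfl fun a₂ _ => Finset.sum_congr rfl fun a₄ _ =>
    Finset.sum_congr rfl fun a₆ _ => ?_
  split_ifs <;> simp_all

lemma card_cubicDisc_ne_zero (hF : ringChar F ≠ 2) :
    ∑ a₂ : F, ∑ a₄ : F, ∑ a₆ : F, (if cubicDisc a₂ a₄ a₆ ≠ 0 then (1 : ℤ) else 0)
      = (Fintype.card F : ℤ) ^ 3 - (Fintype.card F : ℤ) ^ 2 := by
  rw [sum_cubicDisc_ne_zero hF]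
  simp only [Finset.sum_const, Finset.card_univ, nsmul_eq_mul]
  ring

lemma sum_smooth_cubicSum_mul_cubicSum (hF : ringChar F ≠ 2) (hodd : Odd k)
    (hfin : Module.finrank F K = k) :
    ∑ a₂ : F, ∑ a₄ : F, ∑ a₆ : F,
      (if cubicDisc a₂ a₄ a₆ ≠ 0 then cubicSum F a₂ a₄ a₆ * cubicSum K a₂ a₄ a₆ else 0)
      = (Fintype.card F : ℤ) ^ 4 - (Fintype.card F : ℤ) ^ (k + 2)
        - (Fintype.card F : ℤ) ^ 2 + Fintype.card F
        + ∑ c : Fin 4 → F, ∑ x : K, quadraticChar K (quarticValue c x) := by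
  rw [sum_cubicDisc_ne_zero hF, sum_cubicSum_mul_cubicSum hF hodd hfin]
  have h1 : Odd (Module.finrank F F) := by rw [Module.finrank_self]; exact odd_one
  simp only [cubicSum_double_root hF h1, cubicSum_double_root hF (hfin ▸ hodd), neg_mul_neg,
    sum_quadraticChar_sub_sq, Finset.sum_const, Finset.card_univ, nsmul_eq_mul]
  ring

/-- A cubic of non-vanishing discriminant has no multiple root. -/
lemma derivative_ne_zero_of_cubicDisc_ne_zero {F : Type*} [Field F] {a₂ a₄ a₆ r : F}
    (hD : cubicDisc a₂ a₄ a₆ ≠ 0) (h : r ^ 3 + a₂ * r ^ 2 + a₄ * r + a₆ = 0) :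
    3 * r ^ 2 + 2 * a₂ * r + a₄ ≠ 0 := by
  intro h'
  apply hD
  obtain rfl : a₄ = -(3 * r ^ 2 + 2 * a₂ * r) := by linear_combination h'
  obtain rfl : a₆ = 2 * r ^ 3 + a₂ * r ^ 2 := by linear_combination h
  rw [cubicDisc]
  ring

end SingularCubics

section FrobeniusTraces

variable {F : Type*} [Field F] [Fintype F] [DecidableEq F]
  {K : Type*} [Field K] [Fintype K] [DecidableEq K] [Algebra F K]
  {L : Type*} [Field L] [Fintype L] [DecidableEq L] [Algebra F L]

/-- The polynomial `X³ + a₂X² + a₄X + a₆`. -/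
noncomputable def cubicPoly {F : Type*} [Field F] (a₂ a₄ a₆ : F) : F[X] :=
  X ^ 3 + C a₂ * X ^ 2 + C a₄ * X + C a₆

lemma cubicPoly_natDegree {F : Type*} [Field F] (a₂ a₄ a₆ : F) :
    (cubicPoly a₂ a₄ a₆).natDegree = 3 := by
  rw [cubicPoly]
  compute_degree!

lemma cubicPoly_monic {F : Type*} [Field F] (a₂ a₄ a₆ : F) : (cubicPoly a₂ a₄ a₆).Monic := by
  rw [cubicPoly]
  monicity!

lemma mangoldtSum_cubicPoly {k : ℕ} (hF : ringChar F ≠ 2) (hk : k.Prime)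
    (hfin : Module.finrank F K = k) (a₂ a₄ a₆ : F) :
    mangoldtSum (resChar (cubicPoly a₂ a₄ a₆)) k = cubicSum K a₂ a₄ a₆ := by
  rw [mangoldtSum_resChar (K := K) hF (cubicPoly_natDegree a₂ a₄ a₆) hk hfin, cubicSum]
  simp only [cubicPoly, map_add, map_mul, map_pow, aeval_X, aeval_C]

/-- The Newton relations between the character sums over `F` and over its extensions. -/
lemma mangoldtSum_cubicPoly_recurrence (hF : ringChar F ≠ 2) (hL : Module.finrank F L = 2)
    {a₂ a₄ a₆ : F} (hD : cubicDisc a₂ a₄ a₆ ≠ 0) :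
    let s := cubicSum F a₂ a₄ a₆
    let q : ℤ := Fintype.card F
    mangoldtSum (resChar (cubicPoly a₂ a₄ a₆)) 3 = s ^ 3 - 3 * q * s ∧
    mangoldtSum (resChar (cubicPoly a₂ a₄ a₆)) 5 = s ^ 5 - 5 * q * s ^ 3 + 5 * q ^ 2 * s ∧
    mangoldtSum (resChar (cubicPoly a₂ a₄ a₆)) 7
      = s ^ 7 - 7 * q * s ^ 5 + 14 * q ^ 2 * s ^ 3 - 7 * q ^ 3 * s := by
  have heval : ∀ r, (cubicPoly a₂ a₄ a₆).eval r = r ^ 3 + a₂ * r ^ 2 + a₄ * r + a₆ := by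
    intro r
    simp [cubicPoly]
  have hder : ∀ r, (cubicPoly a₂ a₄ a₆).derivative.eval r = 3 * r ^ 2 + 2 * a₂ * r + a₄ := by
    intro r
    simp [cubicPoly]
    ring
  have := mangoldtSum_resChar_recurrence (K := L) hF hL (cubicPoly_monic a₂ a₄ a₆)
    (cubicPoly_natDegree a₂ a₄ a₆) fun r hr => by
      rw [hder]
      rw [heval] at hr
      exact derivative_ne_zero_of_cubicDisc_ne_zero hD hr
  simpa only [heval, cubicSum_self] using this

end FrobeniusTraces

section PointCount

variable {K : Type*} [Field K] [Fintype K] [DecidableEq K]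

lemma WeierstrassCurve.natCast_ptCount (W : WeierstrassCurve K) :
    (W.ptCount K : ℤ) = 1 + ∑ x : K, ∑ y : K,
      (if y ^ 2 + W.a₁ * x * y + W.a₃ * y = x ^ 3 + W.a₂ * x ^ 2 + W.a₄ * x + W.a₆
        then (1 : ℤ) else 0) := by
  rw [WeierstrassCurve.ptCount, Nat.card_eq_fintype_card, Fintype.card_subtype, Finset.card_filter]
  push_cast
  rw [Fintype.sum_prod_type]

lemma WeierstrassCurve.trace_eq_neg_cubicSum (hK : ringChar K ≠ 2) (W : WeierstrassCurve K) :
    (Fintype.card K : ℤ) + 1 - W.ptCount K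
      = -cubicSum K (W.a₂ + W.a₁ ^ 2 / 4) (W.a₄ + W.a₁ * W.a₃ / 2) (W.a₆ + W.a₃ ^ 2 / 4) := by
  have h2 : (2 : K) ≠ 0 := Ring.two_ne_zero hK
  have h4 : (4 : K) ≠ 0 := four_ne_zero_of_ringChar hK
  have key : ∀ x : K, ∑ y : K,
      (if y ^ 2 + W.a₁ * x * y + W.a₃ * y = x ^ 3 + W.a₂ * x ^ 2 + W.a₄ * x + W.a₆
        then (1 : ℤ) else 0) = 1 + quadraticChar K (x ^ 3 + (W.a₂ + W.a₁ ^ 2 / 4) * x ^ 2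
          + (W.a₄ + W.a₁ * W.a₃ / 2) * x + (W.a₆ + W.a₃ ^ 2 / 4)) := by
    intro x
    obtain ⟨a₁, a₂, a₃, a₄, a₆⟩ := W
    obtain ⟨c, rfl⟩ : ∃ c, a₁ = 2 * c := ⟨a₁ / 2, by field_simp⟩
    obtain ⟨d, rfl⟩ : ∃ d, a₃ = 2 * d := ⟨a₃ / 2, by field_simp⟩
    have e1 : (2 * c) ^ 2 / 4 = c ^ 2 := by field_simp; ring
    have e2 : 2 * c * (2 * d) / 2 = 2 * c * d := by field_simp
    have e3 : (2 * d) ^ 2 / 4 = d ^ 2 := by field_simp; ring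
    simp only [e1, e2, e3]
    rw [← sum_ite_sq_eq hK]
    symm
    rw [← sum_comp_add_right _ (c * x + d)]
    refine Finset.sum_congr rfl fun y _ => ?_
    congr 1
    rw [eq_iff_iff]
    constructor <;> intro h <;> linear_combination h
  rw [W.natCast_ptCount, Finset.sum_congr rfl fun x _ => key x, Finset.sum_add_distrib,
    cubicSum_self]
  simp only [Finset.sum_const, Finset.card_univ, nsmul_eq_mul]
  ring

lemma WeierstrassCurve.Δ_eq_cubicDisc {K : Type*} [Field K] (hK : ringChar K ≠ 2) (W : WeierstrassCurve K) :
    W.Δ = 16 * cubicDisc (W.a₂ + W.a₁ ^ 2 / 4) (W.a₄ + W.a₁ * W.a₃ / 2)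
      (W.a₆ + W.a₃ ^ 2 / 4) := by
  have h2 : (2 : K) ≠ 0 := Ring.two_ne_zero hK
  have h4 : (4 : K) ≠ 0 := four_ne_zero_of_ringChar hK
  obtain ⟨a₁, a₂, a₃, a₄, a₆⟩ := W
  obtain ⟨c, rfl⟩ : ∃ c, a₁ = 2 * c := ⟨a₁ / 2, by field_simp⟩
  obtain ⟨d, rfl⟩ : ∃ d, a₃ = 2 * d := ⟨a₃ / 2, by field_simp⟩
  have e1 : (2 * c) ^ 2 / 4 = c ^ 2 := by field_simp; ring
  have e2 : 2 * c * (2 * d) / 2 = 2 * c * d := by field_simp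
  have e3 : (2 * d) ^ 2 / 4 = d ^ 2 := by field_simp; ring
  simp only [WeierstrassCurve.Δ, WeierstrassCurve.b₂, WeierstrassCurve.b₄, WeierstrassCurve.b₆,
    WeierstrassCurve.b₈, cubicDisc, e1, e2, e3]
  ring

lemma sum_weierstrassCurve {K : Type*} [Field K] [Fintype K] (f : WeierstrassCurve K → ℤ) :
    ∑ W, f W = ∑ a₁, ∑ a₂, ∑ a₃, ∑ a₄, ∑ a₆, f ⟨a₁, a₂, a₃, a₄, a₆⟩ := by
  rw [Fintype.sum_equiv (weierstrassEquivTuple K) f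
    (fun v => f ((weierstrassEquivTuple K).symm v)) fun W => by rw [Equiv.symm_apply_apply]]
  simp only [Fintype.sum_prod_type]
  rfl

/-- Sums over smooth curves in odd characteristic reduce to sums over square-free cubics. -/
lemma sum_smooth_weierstrassCurve (hK : ringChar K ≠ 2) (φ : ℤ → ℤ) :
    ∑ W : WeierstrassCurve K, (if W.Δ ≠ 0 then φ ((Fintype.card K : ℤ) + 1 - W.ptCount K) else 0)
      = (Fintype.card K : ℤ) ^ 2 * ∑ a₂ : K, ∑ a₄ : K, ∑ a₆ : K,
        (if cubicDisc a₂ a₄ a₆ ≠ 0 then φ (-cubicSum K a₂ a₄ a₆) else 0) := by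
  have h16 : (16 : K) ≠ 0 := by
    rw [show (16 : K) = 4 * 4 by norm_num]
    exact mul_ne_zero (four_ne_zero_of_ringChar hK) (four_ne_zero_of_ringChar hK)
  have h1 : ∀ W : WeierstrassCurve K,
      (if W.Δ ≠ 0 then φ ((Fintype.card K : ℤ) + 1 - W.ptCount K) else 0)
      = (fun a₂ a₄ a₆ => if cubicDisc a₂ a₄ a₆ ≠ 0 then φ (-cubicSum K a₂ a₄ a₆) else 0)
        (W.a₂ + W.a₁ ^ 2 / 4) (W.a₄ + W.a₁ * W.a₃ / 2) (W.a₆ + W.a₃ ^ 2 / 4) := by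
    intro W
    simp only [W.Δ_eq_cubicDisc hK, W.trace_eq_neg_cubicSum hK, mul_ne_zero_iff, h16, ne_eq,
      not_false_eq_true, true_and]
  have h2 : ∀ (g : K → K → K → ℤ) (a₁ : K), ∑ a₂, ∑ a₃, ∑ a₄, ∑ a₆,
      g (a₂ + a₁ ^ 2 / 4) (a₄ + a₁ * a₃ / 2) (a₆ + a₃ ^ 2 / 4)
      = (Fintype.card K : ℤ) * ∑ a₂, ∑ a₄, ∑ a₆, g a₂ a₄ a₆ := by
    intro g a₁
    rw [Finset.sum_comm, ← smul_eq_mul, Nat.cast_smul_eq_nsmul, ← Finset.card_univ,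
      ← Finset.sum_const]
    exact Finset.sum_congr rfl fun a₃ _ =>
      sum_triangular_shift g (a₁ ^ 2 / 4) (fun _ => a₁ * a₃ / 2) fun _ _ => a₃ ^ 2 / 4
  rw [Finset.sum_congr rfl fun W _ => h1 W, sum_weierstrassCurve]
  refine (Finset.sum_congr rfl fun a₁ _ => h2 (fun a₂ a₄ a₆ =>
    if cubicDisc a₂ a₄ a₆ ≠ 0 then φ (-cubicSum K a₂ a₄ a₆) else 0) a₁).trans ?_
  simp only [Finset.sum_const, Finset.card_univ, nsmul_eq_mul]
  ring

end PointCount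

section Moments

variable {p : ℕ} [Fact p.Prime]

noncomputable instance (n : ℕ) : Fintype (GaloisField p n) := Fintype.ofFinite _

noncomputable instance (n : ℕ) : DecidableEq (GaloisField p n) := Classical.decEq _

/-- The sum of `φ (-s)` over the cubics of non-vanishing discriminant, where `s` is the
character sum of the cubic. -/
def smoothSum (p : ℕ) [Fact p.Prime] (φ : ℤ → ℤ) : ℤ :=
  ∑ a₂ : ZMod p, ∑ a₄ : ZMod p, ∑ a₆ : ZMod p,
    (if cubicDisc a₂ a₄ a₆ ≠ 0 then φ (-cubicSum (ZMod p) a₂ a₄ a₆) else 0)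

lemma smoothSum_add (φ ψ : ℤ → ℤ) :
    smoothSum p (fun t => φ t + ψ t) = smoothSum p φ + smoothSum p ψ := by
  simp only [smoothSum, ← Finset.sum_add_distrib]
  refine Finset.sum_congr rfl fun a₂ _ => Finset.sum_congr rfl fun a₄ _ =>
    Finset.sum_congr rfl fun a₆ _ => ?_
  split_ifs <;> simp

lemma smoothSum_const_mul (c : ℤ) (φ : ℤ → ℤ) :
    smoothSum p (fun t => c * φ t) = c * smoothSum p φ := by
  simp only [smoothSum, Finset.mul_sum, mul_ite, mul_zero]

lemma smoothSum_one (hp : p ≠ 2) : smoothSum p (fun _ => 1) = (p : ℤ) ^ 3 - (p : ℤ) ^ 2 := by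
  have := card_cubicDisc_ne_zero (F := ZMod p) (by rwa [ZMod.ringChar_zmod_n])
  rwa [ZMod.card] at this

/-- If the polynomial `φ` computes the trace of Frobenius over an extension of odd degree from
the one over the base field, the corresponding moment is given by a sum over quartics. -/
lemma smoothSum_mul {K : Type*} [Field K] [Fintype K] [DecidableEq K] [Algebra (ZMod p) K] {k : ℕ}
    (hp : p ≠ 2) (hodd : Odd k) (hfin : Module.finrank (ZMod p) K = k) {φ : ℤ → ℤ}
    (hφ : ∀ a₂ a₄ a₆ : ZMod p, cubicDisc a₂ a₄ a₆ ≠ 0 →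
      φ (-cubicSum (ZMod p) a₂ a₄ a₆) = -cubicSum K a₂ a₄ a₆) :
    smoothSum p (fun t => t * φ t)
      = (p : ℤ) ^ 4 - (p : ℤ) ^ (k + 2) - (p : ℤ) ^ 2 + p
        + ∑ c : Fin 4 → ZMod p, ∑ x : K, quadraticChar K (quarticValue c x) := by
  have h := sum_smooth_cubicSum_mul_cubicSum (F := ZMod p) (K := K)
    (by rwa [ZMod.ringChar_zmod_n]) hodd hfin
  rw [ZMod.card] at h
  rw [← h, smoothSum]
  refine Finset.sum_congr rfl fun a₂ _ => Finset.sum_congr rfl fun a₄ _ =>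
    Finset.sum_congr rfl fun a₆ _ => ?_
  split_ifs with hD
  · rw [hφ _ _ _ hD, neg_mul_neg]
  · rfl

lemma smoothSum_symmPowerPoly_two (hp : p ≠ 2) :
    smoothSum p (symmPowerPoly p 2) = -((p : ℤ) * (p - 1)) := by
  have hF : ringChar (ZMod p) ≠ 2 := by rwa [ZMod.ringChar_zmod_n]
  have h : symmPowerPoly p 2 = fun t => t * t + -(p : ℤ) * 1 := by
    funext t
    simp only [symmPowerPoly]
    ring
  rw [h, smoothSum_add, smoothSum_const_mul, smoothSum_one hp,
    smoothSum_mul (K := ZMod p) (φ := fun t => t) hp odd_one (Module.finrank_self _)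
      fun _ _ _ _ => rfl, sum_quarticValue_of_finrank_one hF]
  ring

lemma smoothSum_symmPowerPoly_four (hp : p ≠ 2) :
    smoothSum p (symmPowerPoly p 4) = -((p : ℤ) * (p - 1)) := by
  have hF : ringChar (ZMod p) ≠ 2 := by rwa [ZMod.ringChar_zmod_n]
  have h : symmPowerPoly p 4 = fun t => t * (t ^ 3 - 3 * p * t) + (p : ℤ) ^ 2 * 1 := by
    funext t
    simp only [symmPowerPoly]
    ring
  have hfin : Module.finrank (ZMod p) (GaloisField p 3) = 3 := GaloisField.finrank p three_ne_zero
  rw [h, smoothSum_add, smoothSum_const_mul, smoothSum_one hp,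
    smoothSum_mul (K := GaloisField p 3) (φ := fun t => t ^ 3 - 3 * p * t) hp (by decide) hfin ?_,
    sum_quarticValue_of_finrank_three hF hfin]
  · ring
  · intro a₂ a₄ a₆ hD
    have := (mangoldtSum_cubicPoly_recurrence (L := GaloisField p 2) hF
      (GaloisField.finrank p two_ne_zero) hD).1
    rw [mangoldtSum_cubicPoly hF Nat.prime_three hfin, ZMod.card] at this
    rw [this]
    ring

lemma smoothSum_symmPowerPoly_six (hp : p ≠ 2) :
    smoothSum p (symmPowerPoly p 6) = -((p : ℤ) * (p - 1)) := by
  have hF : ringChar (ZMod p) ≠ 2 := by rwa [ZMod.ringChar_zmod_n]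
  have h : symmPowerPoly p 6 = fun t => t * (t ^ 5 - 5 * p * t ^ 3 + 5 * p ^ 2 * t)
      + (p : ℤ) ^ 2 * symmPowerPoly p 2 t := by
    funext t
    simp only [symmPowerPoly]
    ring
  have hfin : Module.finrank (ZMod p) (GaloisField p 5) = 5 :=
    GaloisField.finrank p (by decide)
  rw [h, smoothSum_add, smoothSum_const_mul, smoothSum_symmPowerPoly_two hp,
    smoothSum_mul (K := GaloisField p 5) (φ := fun t => t ^ 5 - 5 * p * t ^ 3 + 5 * p ^ 2 * t) hp
      (by decide) hfin ?_,
    sum_quarticValue_of_finrank_five hF (ZMod.isPrimitive_stdAddChar p) hfin, ZMod.card]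
  · ring
  · intro a₂ a₄ a₆ hD
    have := (mangoldtSum_cubicPoly_recurrence (L := GaloisField p 2) hF
      (GaloisField.finrank p two_ne_zero) hD).2.1
    rw [mangoldtSum_cubicPoly hF Nat.prime_five hfin, ZMod.card] at this
    rw [this]
    ring

lemma smoothSum_symmPowerPoly_eight (hp : p ≠ 2) :
    smoothSum p (symmPowerPoly p 8) = -((p : ℤ) * (p - 1)) := by
  have hF : ringChar (ZMod p) ≠ 2 := by rwa [ZMod.ringChar_zmod_n]
  have h : symmPowerPoly p 8 = fun t =>
      t * (t ^ 7 - 7 * p * t ^ 5 + 14 * p ^ 2 * t ^ 3 - 7 * p ^ 3 * t)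
      + (p : ℤ) ^ 2 * symmPowerPoly p 4 t := by
    funext t
    simp only [symmPowerPoly]
    ring
  have hfin : Module.finrank (ZMod p) (GaloisField p 7) = 7 :=
    GaloisField.finrank p (by decide)
  rw [h, smoothSum_add, smoothSum_const_mul, smoothSum_symmPowerPoly_four hp,
    smoothSum_mul (K := GaloisField p 7)
      (φ := fun t => t ^ 7 - 7 * p * t ^ 5 + 14 * p ^ 2 * t ^ 3 - 7 * p ^ 3 * t) hp
      (by decide) hfin ?_,
    sum_quarticValue_of_finrank_seven hF (ZMod.isPrimitive_stdAddChar p) hfin, ZMod.card]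
  · ring
  · intro a₂ a₄ a₆ hD
    have := (mangoldtSum_cubicPoly_recurrence (L := GaloisField p 2) hF
      (GaloisField.finrank p two_ne_zero) hD).2.2
    rw [mangoldtSum_cubicPoly hF Nat.prime_seven hfin, ZMod.card] at this
    rw [this]
    ring

end Moments

/-- The explicit enumeration of the `32` Weierstrass curves over the field with two elements. -/
lemma sum_zmod_two (a : ℕ) (ha : a = 2 ∨ a = 4 ∨ a = 6 ∨ a = 8) :
    ∑ a₁ : ZMod 2, ∑ a₂ : ZMod 2, ∑ a₃ : ZMod 2, ∑ a₄ : ZMod 2, ∑ a₆ : ZMod 2,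
      (if -(a₁ ^ 2 + 4 * a₂) ^ 2 * (a₁ ^ 2 * a₆ + 4 * a₂ * a₆ - a₁ * a₃ * a₄ + a₂ * a₃ ^ 2 - a₄ ^ 2)
          - 8 * (2 * a₄ + a₁ * a₃) ^ 3 - 27 * (a₃ ^ 2 + 4 * a₆) ^ 2
          + 9 * (a₁ ^ 2 + 4 * a₂) * (2 * a₄ + a₁ * a₃) * (a₃ ^ 2 + 4 * a₆) ≠ 0
        then symmPowerPoly 2 a (2 + 1 - (1 + ∑ x : ZMod 2, ∑ y : ZMod 2,
          (if y ^ 2 + a₁ * x * y + a₃ * y = x ^ 3 + a₂ * x ^ 2 + a₄ * x + a₆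
            then (1 : ℤ) else 0)))
        else 0) = -8 := by
  rcases ha with rfl | rfl | rfl | rfl <;> decide +kernel

open scoped Classical in
/-- **Even moments of elliptic curves over `𝔽_p` in the range without cusp forms**: for a
prime `p` and `a ∈ {2, 4, 6, 8}`, the sum of `h_a(t_W)` over all smooth Weierstrass curves
`W` over `ℤ/pℤ` equals `−(p − 1)·p³`, i.e. the weighted moment `σ_a(p)` equals `1`, in
accordance with Eichler–Shimura and the vanishing of cusp forms of weights `4, 6, 8, 10`. -/
theorem even_moments_low_weight (p : ℕ) [Fact p.Prime] (a : ℕ)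
    (ha : a = 2 ∨ a = 4 ∨ a = 6 ∨ a = 8) :
    ∑ W ∈ Finset.univ.filter (fun W : WeierstrassCurve (ZMod p) => W.Δ ≠ 0),
      symmPowerPoly p a ((p : ℤ) + 1 - WeierstrassCurve.ptCount (ZMod p) W)
      = -((p : ℤ) - 1) * p ^ 3 := by
  rw [Finset.sum_filter]
  by_cases hp : p = 2
  · subst hp
    rw [sum_weierstrassCurve]
    simp only [WeierstrassCurve.natCast_ptCount]
    refine Eq.trans ?_ ((sum_zmod_two a ha).trans (by norm_num))
    refine Finset.sum_congr rfl fun a₁ _ => Finset.sum_congr rfl fun a₂ _ =>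
      Finset.sum_congr rfl fun a₃ _ => Finset.sum_congr rfl fun a₄ _ =>
        Finset.sum_congr rfl fun a₆ _ => ?_
    congr 1
  · have h := sum_smooth_weierstrassCurve (K := ZMod p) (by rwa [ZMod.ringChar_zmod_n])
      (symmPowerPoly p a)
    rw [ZMod.card] at h
    have key : smoothSum p (symmPowerPoly p a) = -((p : ℤ) * (p - 1)) := by
      rcases ha with rfl | rfl | rfl | rfl
      exacts [smoothSum_symmPowerPoly_two hp, smoothSum_symmPowerPoly_four hp,
        smoothSum_symmPowerPoly_six hp, smoothSum_symmPowerPoly_eight hp]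
    rw [smoothSum] at key
    rw [key] at h
    refine Eq.trans ?_ (h.trans (by ring))
    refine Finset.sum_congr rfl fun W _ => ?_
    congr 1
end
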